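/- arXiv:math/0411371 — 4 statements merged into one kernel-verified Lean document; each statement's English description precedes it below -/
import Mathlib

section
/- Let N ≥ 2 and let A be an N×N matrix with entries in {0,1} that is irreducible and aperiodic (there exists p ∈ ℤ₊ with all entries of A^p strictly positive). Then there exists a Borel probability measure μ_A on X(A) satisfying the strong invariance property: ∫_{X(A)} f dμ_A = ∫_{X(A)} (1/#r_A⁻¹(x)) Σ_{y : r_A(y)=x} f(y) dμ_A(x) for every bounded measurable function f on X(A). -/
open MeasureTheory

/-- The subshift state space `X(A)` of a 0-1 matrix `A`. -/
def XA {N : ℕ} (A : Matrix (Fin N) (Fin N) ℕ) : Set (ℕ → Fin N) :=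
  {x | ∀ i, A (x i) (x (i + 1)) = 1}

/-- The restriction `r_A` of the left shift to `X(A)`. -/
def shiftA {N : ℕ} (A : Matrix (Fin N) (Fin N) ℕ) (x : XA A) : XA A :=
  ⟨fun n => (x : ℕ → Fin N) (n + 1), fun i => x.2 (i + 1)⟩

/-- Bounded measurable real functions. -/
def BddMeasurable {Y : Type} [MeasurableSpace Y] (f : Y → ℝ) : Prop :=
  Measurable f ∧ ∃ C, ∀ x, |f x| ≤ C

/-- The averaging (transfer) operator `f ↦ (1/#r⁻¹(x)) Σ_{r(y)=x} f(y)`. -/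
noncomputable def transfer {Y : Type} (r : Y → Y) (f : Y → ℝ) (x : Y) : ℝ :=
  (Nat.card (r ⁻¹' {x}) : ℝ)⁻¹ * ∑' y : r ⁻¹' {x}, f y

/-- Strong `r`-invariance of a measure: `∫ f dμ = ∫ (1/#r⁻¹(x)) Σ_{r(y)=x} f(y) dμ(x)`
for every bounded measurable `f`. -/
def StronglyInvariant {Y : Type} [MeasurableSpace Y] (r : Y → Y) (μ : Measure Y) : Prop :=
  ∀ f : Y → ℝ, BddMeasurable f → ∫ x, f x ∂μ = ∫ x, transfer r f x ∂μ

open Filter Topology BoundedContinuousFunction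

section KB

variable {E : Type} [MeasurableSpace E] {ι : Type} [Fintype ι]

/-- The dual averaging operator on measures. -/
noncomputable def dualS (w : ι → E → ℝ) (g : ι → E → E) (ν : Measure E) : Measure E :=
  ∑ i, Measure.map (g i) (ν.withDensity (fun x => ENNReal.ofReal (w i x)))

lemma dualS_prob (w : ι → E → ℝ) (g : ι → E → E) (hw : ∀ i, Measurable (w i))
    (hg : ∀ i, Measurable (g i)) (h0 : ∀ i x, 0 ≤ w i x) (h1 : ∀ x, ∑ i, w i x = 1)
    (ν : Measure E) [IsProbabilityMeasure ν] : IsProbabilityMeasure (dualS w g ν) := by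
  constructor
  simp only [dualS, Measure.coe_finsetSum, Finset.sum_apply]
  have : ∀ i, Measure.map (g i) (ν.withDensity (fun x => ENNReal.ofReal (w i x))) Set.univ
      = ∫⁻ x, ENNReal.ofReal (w i x) ∂ν := by
    intro i
    rw [Measure.map_apply (hg i) MeasurableSet.univ, Set.preimage_univ,
      withDensity_apply _ MeasurableSet.univ, Measure.restrict_univ]
  simp only [this]
  rw [← lintegral_finsetSum _ (fun i _ => (hw i).ennreal_ofReal)]
  have : ∀ x, ∑ i, ENNReal.ofReal (w i x) = 1 := by
    intro x
    rw [← ENNReal.ofReal_sum_of_nonneg (fun i _ => h0 i x), h1, ENNReal.ofReal_one]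
  simp [this]

lemma w_le_one (w : ι → E → ℝ) (h0 : ∀ i x, 0 ≤ w i x) (h1 : ∀ x, ∑ i, w i x = 1)
    (i : ι) (x : E) : w i x ≤ 1 := by
  rw [← h1 x]
  exact Finset.single_le_sum (f := fun i => w i x) (fun j _ => h0 j x) (Finset.mem_univ i)

lemma integral_dualS (w : ι → E → ℝ) (g : ι → E → E) (hw : ∀ i, Measurable (w i))
    (hg : ∀ i, Measurable (g i)) (h0 : ∀ i x, 0 ≤ w i x) (h1 : ∀ x, ∑ i, w i x = 1)
    (ν : Measure E) [IsProbabilityMeasure ν] (f : E → ℝ) (hf : Measurable f)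
    (C : ℝ) (hC : ∀ x, |f x| ≤ C) :
    ∫ x, f x ∂(dualS w g ν) = ∫ x, ∑ i, w i x * f (g i x) ∂ν := by
  have hint : ∀ i, Integrable (fun x => w i x * f (g i x)) ν := by
    intro i
    refine Integrable.of_bound ((hw i).mul (hf.comp (hg i))).aestronglyMeasurable C ?_
    refine Eventually.of_forall fun x => ?_
    rw [norm_mul, Real.norm_eq_abs, Real.norm_eq_abs, abs_of_nonneg (h0 i x)]
    have := w_le_one w h0 h1 i x
    have := hC (g i x)
    have := abs_nonneg (f (g i x))
    have := h0 i x
    nlinarith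
  have hprob := dualS_prob w g hw hg h0 h1 ν
  have hfin : ∀ i, IsFiniteMeasure
      (Measure.map (g i) (ν.withDensity (fun x => ENNReal.ofReal (w i x)))) := by
    intro i
    refine ⟨lt_of_le_of_lt ?_ (measure_lt_top (dualS w g ν) Set.univ)⟩
    simp only [dualS, Measure.coe_finsetSum, Finset.sum_apply]
    exact Finset.single_le_sum
      (f := fun i => Measure.map (g i) (ν.withDensity (fun x => ENNReal.ofReal (w i x))) Set.univ)
      (fun j _ => zero_le) (Finset.mem_univ i)
  rw [integral_finsetSum _ (fun i _ => hint i), dualS, integral_finsetSum_measure]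
  · refine Finset.sum_congr rfl fun i _ => ?_
    rw [integral_map (hg i).aemeasurable hf.aestronglyMeasurable,
      integral_withDensity_eq_integral_toReal_smul (hw i).ennreal_ofReal (by simp)]
    refine integral_congr_ae (Eventually.of_forall fun x => ?_)
    simp [ENNReal.toReal_ofReal (h0 i x)]
  · intro i _
    have := hfin i
    exact Integrable.of_bound hf.aestronglyMeasurable C (Eventually.of_forall hC)

theorem krylov_bogoliubov [TopologicalSpace E] [CompactSpace E] [T2Space E] [BorelSpace E]
    [HasOuterApproxClosed E] [Nonempty E]
    (w : ι → E → ℝ) (g : ι → E → E) (hw : ∀ i, Continuous (w i))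
    (hg : ∀ i, Continuous (g i)) (h0 : ∀ i x, 0 ≤ w i x) (h1 : ∀ x, ∑ i, w i x = 1) :
    ∃ μ : Measure E, IsProbabilityMeasure μ ∧ ∀ f : E → ℝ, Measurable f →
      (∃ C, ∀ x, |f x| ≤ C) → ∫ x, f x ∂μ = ∫ x, ∑ i, w i x * f (g i x) ∂μ := by
  have hwm := fun i => (hw i).measurable
  have hgm := fun i => (hg i).measurable
  obtain ⟨x0⟩ := ‹Nonempty E›
  let ν : ℕ → Measure E := fun k => (dualS w g)^[k] (Measure.dirac x0)
  have hνs : ∀ k, ν (k + 1) = dualS w g (ν k) := fun k => Function.iterate_succ_apply' _ _ _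
  have hν : ∀ k, IsProbabilityMeasure (ν k) := by
    intro k
    induction k with
    | zero => exact (inferInstance : IsProbabilityMeasure (Measure.dirac x0))
    | succ k ih => rw [hνs]; exact dualS_prob w g hwm hgm h0 h1 _
  let M : ℕ → Measure E := fun n =>
    ((n : ENNReal) + 1)⁻¹ • ∑ k ∈ Finset.range (n + 1), ν k
  have hM : ∀ n, IsProbabilityMeasure (M n) := by
    intro n
    constructor
    simp only [M, Measure.smul_apply, Measure.coe_finsetSum, Finset.sum_apply, measure_univ,
      Finset.sum_const, Finset.card_range, smul_eq_mul, nsmul_eq_mul, mul_one]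
    push_cast
    exact ENNReal.inv_mul_cancel (by simp) (by simp)
  have hMint : ∀ n (f : E →ᵇ ℝ), ∫ x, f x ∂(M n)
      = ((n : ℝ) + 1)⁻¹ * ∑ k ∈ Finset.range (n + 1), ∫ x, f x ∂(ν k) := by
    intro n f
    simp only [M]
    rw [integral_smul_measure, integral_finsetSum_measure]
    · simp [ENNReal.toReal_add]
    · intro k _
      exact f.integrable _
  let P : ℕ → ProbabilityMeasure E := fun n => ⟨M n, hM n⟩
  let U : Ultrafilter ℕ := hyperfilter ℕ
  obtain ⟨μ, -, hμ⟩ := isCompact_univ.ultrafilter_le_nhds (U.map P) (by simp)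
  have hU : Tendsto P U (𝓝 μ) := hμ
  have hUint := ProbabilityMeasure.tendsto_iff_forall_integral_tendsto.1 hU
  have hUtop : (U : Filter ℕ) ≤ atTop := by
    rw [← Nat.cofinite_eq_atTop]; exact hyperfilter_le_cofinite
  have hSμ := dualS_prob w g hwm hgm h0 h1 (μ : Measure E)
  have key : (μ : Measure E) = dualS w g (μ : Measure E) := by
    refine ext_of_forall_integral_eq_of_IsFiniteMeasure fun f => ?_
    have hfb : ∀ x, |f x| ≤ ‖f‖ := fun x => f.norm_coe_le_norm x
    rw [integral_dualS w g hwm hgm h0 h1 _ f f.continuous.measurable ‖f‖ hfb]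
    let F : E →ᵇ ℝ := BoundedContinuousFunction.mkOfCompact
      ⟨fun x => ∑ i, w i x * f (g i x), by fun_prop⟩
    have hF : ∀ x, F x = ∑ i, w i x * f (g i x) := fun x => rfl
    simp only [← hF]
    have t1 := hUint f
    have t2 := hUint F
    have hdiff : ∀ n, ∫ x, f x ∂(M n) - ∫ x, F x ∂(M n)
        = ((n : ℝ) + 1)⁻¹ * (∫ x, f x ∂(ν 0) - ∫ x, f x ∂(ν (n + 1))) := by
      intro n
      rw [hMint, hMint, ← mul_sub, ← Finset.sum_sub_distrib,
        ← Finset.sum_range_sub' (fun k => ∫ x, f x ∂(ν k))]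
      congr 1
      refine Finset.sum_congr rfl fun k _ => ?_
      rw [hνs, integral_dualS w g hwm hgm h0 h1 _ f f.continuous.measurable ‖f‖ hfb]
      simp only [hF]
    have t3 : Tendsto (fun n => ∫ x, f x ∂(M n) - ∫ x, F x ∂(M n)) U (𝓝 0) := by
      refine Tendsto.mono_left ?_ hUtop
      simp only [hdiff]
      have hb : ∀ k, |∫ x, f x ∂(ν k)| ≤ ‖f‖ := by
        intro k
        have := norm_integral_le_of_norm_le_const (μ := ν k) (f := f) (C := ‖f‖)
          (Eventually.of_forall hfb)
        simpa using this
      refine squeeze_zero_norm (a := fun n : ℕ => (2 * ‖f‖) * (1 / ((n : ℝ) + 1))) ?_ ?_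
      · intro n
        rw [norm_mul, mul_comm, norm_inv, Real.norm_of_nonneg (by positivity : (0:ℝ) ≤ n + 1),
          one_div, Real.norm_eq_abs]
        gcongr
        have a := hb 0
        have b := hb (n + 1)
        rw [abs_le] at *
        constructor <;> linarith
      · simpa using tendsto_one_div_add_atTop_nhds_zero_nat.const_mul (2 * ‖f‖)
    have := tendsto_nhds_unique (t1.sub t2) t3
    linarith
  refine ⟨μ, inferInstance, fun f hf ⟨C, hC⟩ => ?_⟩
  rw [← integral_dualS w g hwm hgm h0 h1 _ f hf C hC, ← key]

end KB

section Shift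

variable {N : ℕ} (A : Matrix (Fin N) (Fin N) ℕ)

lemma XA_isClosed : IsClosed (XA A) := by
  have : XA A = ⋂ i, (fun x : ℕ → Fin N => A (x i) (x (i + 1))) ⁻¹' {1} := by
    ext x; simp [XA]
  rw [this]
  refine isClosed_iInter fun i => IsClosed.preimage ?_ (isClosed_discrete _)
  have h1 : Continuous fun p : Fin N × Fin N => A p.1 p.2 := continuous_of_discreteTopology
  have h2 : Continuous fun x : ℕ → Fin N => (x i, x (i + 1)) :=
    (continuous_apply i).prodMk (continuous_apply (i + 1))
  exact h1.comp h2

/-- Prepend the letter `i` (first coordinate), on sequences. -/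
def consSeq (i : Fin N) (x : ℕ → Fin N) : ℕ → Fin N
  | 0 => i
  | n + 1 => x n

/-- Prepend the letter `i` if allowed. -/
noncomputable def pre (i : Fin N) (x : XA A) : XA A :=
  if h : A i (x.1 0) = 1 then ⟨consSeq i x.1, fun n => by
    cases n with
    | zero => exact h
    | succ n => exact x.2 n⟩ else x

lemma pre_continuous (i : Fin N) : Continuous (pre A i) := by
  refine continuous_induced_rng.2 (continuous_pi fun n => ?_)
  have hx : ∀ m, Continuous fun x : XA A => x.1 m := fun m =>
    (continuous_apply m).comp continuous_subtype_val
  cases n with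
  | zero =>
    have : (fun x : XA A => (Subtype.val ∘ pre A i) x 0)
        = (fun j : Fin N => if A i j = 1 then i else j) ∘ fun x : XA A => x.1 0 := by
      funext x
      by_cases h : A i (x.1 0) = 1 <;> simp [pre, h, consSeq]
    rw [this]
    exact continuous_of_discreteTopology.comp (hx 0)
  | succ n =>
    have : (fun x : XA A => (Subtype.val ∘ pre A i) x (n + 1))
        = (fun j : Fin N × Fin N × Fin N => if A i j.1 = 1 then j.2.1 else j.2.2)
          ∘ fun x : XA A => (x.1 0, x.1 n, x.1 (n + 1)) := by
      funext x
      by_cases h : A i (x.1 0) = 1 <;> simp [pre, h, consSeq]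
    rw [this]
    exact continuous_of_discreteTopology.comp ((hx 0).prodMk ((hx n).prodMk (hx (n + 1))))

/-- The fibre of the shift is indexed by the admissible first letters. -/
noncomputable def fibreEquiv (x : XA A) :
    {i : Fin N // A i (x.1 0) = 1} ≃ (shiftA A ⁻¹' {x}) where
  toFun i := ⟨pre A i.1 x, by
    simp only [Set.mem_preimage, Set.mem_singleton_iff]
    apply Subtype.ext
    funext n
    simp [shiftA, pre, i.2, consSeq]⟩
  invFun y := ⟨y.1.1 0, by
    have h : shiftA A y.1 = x := y.2
    have h' : x.1 0 = y.1.1 1 := (congrArg (fun z : XA A => z.1 0) h).symm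
    have h2 : A (y.1.1 0) (y.1.1 1) = 1 := y.1.2 0
    exact h' ▸ h2⟩
  left_inv i := by
    apply Subtype.ext
    simp [pre, i.2, consSeq]
  right_inv y := by
    obtain ⟨y, hy⟩ := y
    have h : shiftA A y = x := hy
    subst h
    apply Subtype.ext
    apply Subtype.ext
    funext n
    have : A (y.1 0) ((shiftA A y).1 0) = 1 := y.2 0
    simp only [pre]
    rw [dif_pos this]
    cases n <;> rfl

/-- Number of admissible letters before `j`. -/
def colCard (j : Fin N) : ℕ := (Finset.univ.filter fun i => A i j = 1).card

/-- Weights. -/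
noncomputable def wt (i : Fin N) (x : XA A) : ℝ :=
  (colCard A (x.1 0) : ℝ)⁻¹ * if A i (x.1 0) = 1 then 1 else 0

lemma transfer_eq (f : XA A → ℝ) (x : XA A) :
    transfer (shiftA A) f x = ∑ i, wt A i x * f (pre A i x) := by
  have hc : Nat.card (shiftA A ⁻¹' {x}) = colCard A (x.1 0) := by
    rw [← Nat.card_congr (fibreEquiv A x), Nat.card_eq_fintype_card, Fintype.card_subtype, colCard]
  have hs : ∑' y : shiftA A ⁻¹' {x}, f y
      = ∑ i, (if A i (x.1 0) = 1 then 1 else 0) * f (pre A i x) := by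
    rw [← (fibreEquiv A x).tsum_eq, tsum_fintype]
    simp only [ite_mul, one_mul, zero_mul]
    rw [← Finset.sum_filter]
    exact (Finset.sum_subtype _ (by simp) (fun i => f (pre A i x))).symm
  simp only [transfer, wt]
  rw [hc, hs, Finset.mul_sum]
  exact Finset.sum_congr rfl fun i _ => by ring

end Shift

/-- If `A` is an irreducible and aperiodic 0-1 matrix, then there exists a Borel probability
measure `μ_A` on `X(A)` which is strongly invariant for the shift `r_A`. -/
theorem exists_strongly_invariant_measure_subshift (N : ℕ) (hN : 2 ≤ N)
    (A : Matrix (Fin N) (Fin N) ℕ)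
    (h01 : ∀ i j, A i j = 0 ∨ A i j = 1)
    (hirr : ∀ j, ∃ i, A i j = 1)
    (haper : ∃ p : ℕ, 0 < p ∧ ∀ i j, 0 < (A ^ p) i j) :
    ∃ μA : Measure (XA A), IsProbabilityMeasure μA ∧ StronglyInvariant (shiftA A) μA := by
  have hrow : ∀ i, ∃ j, A i j = 1 := by
    intro i
    obtain ⟨p, hp, h⟩ := haper
    obtain ⟨q, rfl⟩ : ∃ q, p = q + 1 := ⟨p - 1, by omega⟩
    by_contra hcon
    push Not at hcon
    have hz : ∀ j, A i j = 0 := fun j => (h01 i j).resolve_right (hcon j)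
    have := h i i
    rw [pow_succ', Matrix.mul_apply] at this
    simp [hz] at this
  choose s hs using hrow
  have hne : Nonempty (XA A) := by
    refine ⟨⟨fun n => s^[n] ⟨0, by omega⟩, fun n => ?_⟩⟩
    have h := hs (s^[n] ⟨0, by omega⟩)
    rw [← Function.iterate_succ_apply' s] at h
    exact h
  have hcomp : CompactSpace (XA A) := isCompact_iff_compactSpace.1 (XA_isClosed A).isCompact
  have hpos : ∀ j, (colCard A j : ℝ) ≠ 0 := by
    intro j
    obtain ⟨i, hi⟩ := hirr j
    have : 0 < colCard A j := Finset.card_pos.2 ⟨i, by simp [hi]⟩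
    exact_mod_cast this.ne'
  let _ : MetricSpace (XA A) := TopologicalSpace.metrizableSpaceMetric (XA A)
  obtain ⟨μ, hμ, h⟩ := krylov_bogoliubov (wt A) (pre A)
    (fun i => (continuous_of_discreteTopology
      (f := fun j : Fin N => (colCard A j : ℝ)⁻¹ * if A i j = 1 then 1 else 0)).comp
        ((continuous_apply 0).comp continuous_subtype_val))
    (pre_continuous A)
    (fun i x => by unfold wt; positivity)
    (fun x => by
      simp only [wt]
      rw [← Finset.mul_sum, Finset.sum_boole]
      exact inv_mul_cancel₀ (hpos _))
  refine ⟨μ, hμ, fun f hf => ?_⟩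
  rw [h f hf.1 hf.2]
  simp only [transfer_eq]
end

section
/- Let (X,𝔅) be a measure space, r : X → X a measurable, onto, finite-to-one map, and μ a probability measure on X that is strongly r-invariant. Let m₀ ∈ L^∞(X) and let h ∈ L¹(X,μ), h ≥ 0, satisfy (1/#r⁻¹(x)) Σ_{y : r(y)=x} |m₀(y)|² h(y) = h(x) for μ-a.e. x ∈ X. Then there exist, uniquely up to an intertwining unitary isomorphism, a Hilbert space H, a unitary operator U on H, a representation π of L^∞(X) on H, and a vector φ ∈ H such that: (i) U π(f) U⁻¹ = π(f∘r) for all f ∈ L^∞(X); (ii) ⟨φ, π(f)φ⟩ = ∫_X f h dμ for all f ∈ L^∞(X); (iii) Uφ = π(m₀)φ; (iv) the closed linear span of {U⁻ⁿ π(f) φ : n ≥ 0, f ∈ L^∞(X)} equals H. -/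
open MeasureTheory (Measure Integrable IsProbabilityMeasure)
open scoped InnerProductSpace

/-- Bounded measurable complex functions (representatives of elements of `L^∞`). -/
def BddMeasC {Y : Type} [MeasurableSpace Y] (f : Y → ℂ) : Prop :=
  Measurable f ∧ ∃ C, ∀ x, ‖f x‖ ≤ C

/-- The Ruelle transfer operator with weight `W`. -/
noncomputable def ruelle {Y : Type} (r : Y → Y) (W : Y → ℝ) (f : Y → ℝ) (x : Y) : ℝ :=
  (Nat.card (r ⁻¹' {x}) : ℝ)⁻¹ * ∑' y : r ⁻¹' {x}, W y * f y

/-- A covariant system `(H, U, π, φ)` associated to `m₀` and `h`:  `π` is a (normal, i.e.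
respecting a.e. equality) unital *-representation of `L^∞(X)` (given on bounded measurable
representatives), `U` a unitary with `U π(f) U⁻¹ = π(f∘r)`, `φ` a cyclic vector with
`⟨φ, π(f)φ⟩ = ∫ f h dμ` and `Uφ = π(m₀)φ`. -/
structure CovariantSystem (X : Type) [MeasurableSpace X] (r : X → X) (μ : Measure X)
    (m₀ : X → ℂ) (h : X → ℝ) where
  H : Type
  [grp : NormedAddCommGroup H]
  [ips : InnerProductSpace ℂ H]
  [cpl : CompleteSpace H]
  U : H ≃ₗᵢ[ℂ] H
  ρ : (X → ℂ) → (H →L[ℂ] H)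
  φ : H
  rep_add : ∀ f g, BddMeasC f → BddMeasC g → ρ (f + g) = ρ f + ρ g
  rep_smul : ∀ (c : ℂ) f, BddMeasC f → ρ (c • f) = c • ρ f
  rep_mul : ∀ f g, BddMeasC f → BddMeasC g → ρ (f * g) = ρ f * ρ g
  rep_one : ρ 1 = 1
  rep_star : ∀ f, BddMeasC f → ρ (star f) = star (ρ f)
  rep_ae : ∀ f g, BddMeasC f → BddMeasC g → f =ᵐ[μ] g → ρ f = ρ g
  covariant : ∀ f, BddMeasC f → ∀ v : H, U (ρ f (U.symm v)) = ρ (f ∘ r) v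
  vector_state : ∀ f, BddMeasC f → ⟪φ, ρ f φ⟫_ℂ = ∫ x, f x * (h x : ℂ) ∂μ
  scaling : U φ = ρ m₀ φ
  cyclic : Submodule.topologicalClosure (Submodule.span ℂ
      {v : H | ∃ (n : ℕ) (f : X → ℂ), BddMeasC f ∧ v = (⇑U.symm)^[n] (ρ f φ)}) = ⊤

attribute [instance] CovariantSystem.grp CovariantSystem.ips CovariantSystem.cpl

section Uniqueness

/-- Two total families with the same Gram matrix are related by a unitary. -/
theorem exists_unitary_of_gram {ι H₁ H₂ : Type} [NormedAddCommGroup H₁] [InnerProductSpace ℂ H₁]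
    [CompleteSpace H₁] [NormedAddCommGroup H₂] [InnerProductSpace ℂ H₂] [CompleteSpace H₂]
    (v : ι → H₁) (w : ι → H₂)
    (hv : (Submodule.span ℂ (Set.range v)).topologicalClosure = ⊤)
    (hw : (Submodule.span ℂ (Set.range w)).topologicalClosure = ⊤)
    (hvw : ∀ i j, ⟪v i, v j⟫_ℂ = ⟪w i, w j⟫_ℂ) :
    ∃ W : H₁ ≃ₗᵢ[ℂ] H₂, ∀ i, W (v i) = w i := by
  have d₁ : DenseRange (Finsupp.linearCombination ℂ v) := by
    rw [← Submodule.dense_iff_topologicalClosure_eq_top, ← Finsupp.range_linearCombination] at hv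
    rw [LinearMap.coe_range] at hv
    exact hv
  have d₂ : DenseRange (Finsupp.linearCombination ℂ w) := by
    rw [← Submodule.dense_iff_topologicalClosure_eq_top, ← Finsupp.range_linearCombination] at hw
    rw [LinearMap.coe_range] at hw
    exact hw
  have hn : ∀ x : ι →₀ ℂ, ‖Finsupp.linearCombination ℂ w (LinearEquiv.refl ℂ _ x)‖
      = ‖Finsupp.linearCombination ℂ v x‖ := by
    intro x
    rw [@norm_eq_sqrt_re_inner ℂ, @norm_eq_sqrt_re_inner ℂ]
    simp only [LinearEquiv.refl_apply, Finsupp.linearCombination_apply, Finsupp.sum_inner,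
      Finsupp.inner_sum, inner_smul_left,
      inner_smul_right, hvw]
  refine ⟨(LinearEquiv.refl ℂ (ι →₀ ℂ)).extendOfIsometry _ _ d₁ d₂ hn, fun i => ?_⟩
  have := LinearEquiv.extendOfIsometry_eq (LinearEquiv.refl ℂ (ι →₀ ℂ)) _ _ d₁ d₂ hn
    (Finsupp.single i 1)
  simpa using this

theorem BddMeasC.mul {Y : Type} [MeasurableSpace Y] {f g : Y → ℂ} (hf : BddMeasC f)
    (hg : BddMeasC g) : BddMeasC (f * g) := by
  obtain ⟨hf, C, hC⟩ := hf
  obtain ⟨hg, D, hD⟩ := hg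
  refine ⟨hf.mul hg, C * D, fun x => ?_⟩
  simp only [Pi.mul_apply, norm_mul]
  exact mul_le_mul (hC x) (hD x) (norm_nonneg _) ((norm_nonneg _).trans (hC x))

theorem BddMeasC.add {Y : Type} [MeasurableSpace Y] {f g : Y → ℂ} (hf : BddMeasC f)
    (hg : BddMeasC g) : BddMeasC (f + g) := by
  obtain ⟨hf, C, hC⟩ := hf
  obtain ⟨hg, D, hD⟩ := hg
  exact ⟨hf.add hg, C + D, fun x => norm_add_le_of_le (hC x) (hD x)⟩

theorem BddMeasC.star {Y : Type} [MeasurableSpace Y] {f : Y → ℂ} (hf : BddMeasC f) :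
    BddMeasC (star f) := by
  obtain ⟨hf, C, hC⟩ := hf
  exact ⟨continuous_star.measurable.comp hf, C, fun x => by simpa using hC x⟩

theorem BddMeasC.const {Y : Type} [MeasurableSpace Y] (c : ℂ) : BddMeasC (fun _ : Y => c) :=
  ⟨measurable_const, ‖c‖, fun _ => le_rfl⟩

theorem BddMeasC.one {Y : Type} [MeasurableSpace Y] : BddMeasC (1 : Y → ℂ) :=
  BddMeasC.const 1

theorem BddMeasC.smul {Y : Type} [MeasurableSpace Y] {f : Y → ℂ} (c : ℂ) (hf : BddMeasC f) :
    BddMeasC (c • f) := (BddMeasC.const c).mul hf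

theorem BddMeasC.comp {Y : Type} [MeasurableSpace Y] {f : Y → ℂ} (hf : BddMeasC f) {r : Y → Y}
    (hr : Measurable r) : BddMeasC (f ∘ r) :=
  ⟨hf.1.comp hr, hf.2.imp fun _ h x => h (r x)⟩

variable {X : Type} [MeasurableSpace X] {r : X → X} {μ : Measure X} {m₀ : X → ℂ} {h : X → ℝ}

namespace CovariantSystem

variable (S : CovariantSystem X r μ m₀ h)

/-- The generating vectors. -/
def vec (n : ℕ) (f : X → ℂ) : S.H := (⇑S.U.symm)^[n] (S.ρ f S.φ)

theorem U_rho (f : X → ℂ) (hf : BddMeasC f) (v : S.H) : S.U (S.ρ f v) = S.ρ (f ∘ r) (S.U v) := by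
  rw [← S.covariant f hf, S.U.symm_apply_apply]

theorem U_vec_zero (hr : Measurable r) (hm₀ : BddMeasC m₀) (f : X → ℂ) (hf : BddMeasC f) :
    S.U (S.vec 0 f) = S.vec 0 ((f ∘ r) * m₀) := by
  simp [vec, S.U_rho f hf, S.scaling, S.rep_mul _ _ (hf.comp hr) hm₀]

theorem U_vec_succ (n : ℕ) (f : X → ℂ) : S.U (S.vec (n + 1) f) = S.vec n f := by
  simp [vec, Function.iterate_succ_apply']

theorem vec_succ (n : ℕ) (f : X → ℂ) : S.vec (n + 1) f = S.U.symm (S.vec n f) := by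
  simp [vec, Function.iterate_succ_apply']

theorem vec_eq_succ (hr : Measurable r) (hm₀ : BddMeasC m₀) (n : ℕ) (f : X → ℂ)
    (hf : BddMeasC f) : S.vec n f = S.vec (n + 1) ((f ∘ r) * m₀) := by
  induction n with
  | zero => rw [vec_succ, ← S.U_vec_zero hr hm₀ f hf, S.U.symm_apply_apply]
  | succ n ih => rw [vec_succ, ih, ← vec_succ]

theorem exists_vec_add (hr : Measurable r) (hm₀ : BddMeasC m₀) (n k : ℕ) (f : X → ℂ)
    (hf : BddMeasC f) : ∃ g, BddMeasC g ∧ ∀ S : CovariantSystem X r μ m₀ h,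
      S.vec n f = S.vec (n + k) g := by
  induction k with
  | zero => exact ⟨f, hf, fun S => rfl⟩
  | succ k ih =>
    obtain ⟨g, hg, H⟩ := ih
    exact ⟨(g ∘ r) * m₀, (hg.comp hr).mul hm₀, fun S => by
      rw [H, S.vec_eq_succ hr hm₀ _ _ hg]; rfl⟩

theorem inner_vec_same (n : ℕ) (f g : X → ℂ) (hf : BddMeasC f) (hg : BddMeasC g) :
    ⟪S.vec n f, S.vec n g⟫_ℂ = ∫ x, (star f * g) x * (h x : ℂ) ∂μ := by
  induction n with
  | zero =>
    rw [← S.vector_state _ (hf.star.mul hg), S.rep_mul _ _ hf.star hg, S.rep_star _ hf]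
    simp [vec, ContinuousLinearMap.star_eq_adjoint, ContinuousLinearMap.adjoint_inner_right]
  | succ n ih => rw [vec_succ, vec_succ, S.U.symm.inner_map_map, ih]

theorem inner_vec_eq (T : CovariantSystem X r μ m₀ h) (hr : Measurable r) (hm₀ : BddMeasC m₀)
    (n k : ℕ) (f g : X → ℂ) (hf : BddMeasC f) (hg : BddMeasC g) :
    ⟪S.vec n f, S.vec k g⟫_ℂ = ⟪T.vec n f, T.vec k g⟫_ℂ := by
  obtain ⟨f', hf', Hf⟩ := exists_vec_add (μ := μ) (h := h) hr hm₀ n k f hf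
  obtain ⟨g', hg', Hg⟩ := exists_vec_add (μ := μ) (h := h) hr hm₀ k n g hg
  rw [Hf, Hf, Hg, Hg, add_comm k n, inner_vec_same _ _ _ _ hf' hg', inner_vec_same _ _ _ _ hf' hg']

theorem rho_vec (hr : Measurable r) (n : ℕ) (f g : X → ℂ) (hf : BddMeasC f) (hg : BddMeasC g) :
    S.ρ f (S.vec n g) = S.vec n ((f ∘ r^[n]) * g) := by
  induction n generalizing f with
  | zero => simp [vec, S.rep_mul _ _ hf hg]
  | succ n ih =>
    apply S.U.injective
    rw [S.U_rho f hf, U_vec_succ, U_vec_succ, ih _ (hf.comp hr)]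
    rw [Function.comp_assoc, Function.iterate_succ']

theorem closure_range_vec : (Submodule.span ℂ (Set.range
    fun p : ℕ × {f : X → ℂ // BddMeasC f} => S.vec p.1 p.2.1)).topologicalClosure = ⊤ := by
  rw [← S.cyclic]
  congr 2
  ext v
  constructor
  · rintro ⟨⟨n, f, hf⟩, rfl⟩; exact ⟨n, f, hf, rfl⟩
  · rintro ⟨n, f, hf, rfl⟩; exact ⟨⟨n, f, hf⟩, rfl⟩

theorem ext_of_vec {F : Type} [NormedAddCommGroup F] [NormedSpace ℂ F] (A B : S.H →L[ℂ] F)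
    (hAB : ∀ n f, BddMeasC f → A (S.vec n f) = B (S.vec n f)) : A = B := by
  apply ContinuousLinearMap.ext_on
    (s := Set.range fun p : ℕ × {f : X → ℂ // BddMeasC f} => S.vec p.1 p.2.1)
  · rw [Submodule.dense_iff_topologicalClosure_eq_top]; exact S.closure_range_vec
  · rintro _ ⟨⟨n, f, hf⟩, rfl⟩; exact hAB n f hf

theorem unique (T : CovariantSystem X r μ m₀ h) (hr : Measurable r) (hm₀ : BddMeasC m₀) :
    ∃ W : S.H ≃ₗᵢ[ℂ] T.H,
      (∀ (f : X → ℂ), BddMeasC f → ∀ v : S.H, W (S.ρ f v) = T.ρ f (W v)) ∧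
      (∀ v : S.H, W (S.U v) = T.U (W v)) ∧ W S.φ = T.φ := by
  obtain ⟨W, hW⟩ := exists_unitary_of_gram _ _ S.closure_range_vec T.closure_range_vec
    (fun i j => S.inner_vec_eq T hr hm₀ _ _ _ _ i.2.2 j.2.2)
  replace hW : ∀ n f, BddMeasC f → W (S.vec n f) = T.vec n f := fun n f hf => hW ⟨n, f, hf⟩
  let W' : S.H →L[ℂ] T.H := W.toContinuousLinearEquiv.toContinuousLinearMap
  have hW' : ∀ v, W' v = W v := fun _ => rfl
  refine ⟨W, fun f hf v => ?_, fun v => ?_, ?_⟩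
  · have := S.ext_of_vec (W' ∘L S.ρ f) (T.ρ f ∘L W') (fun n g hg => by
      have hb : BddMeasC ((f ∘ r^[n]) * g) := (hf.comp (hr.iterate n)).mul hg
      simp only [ContinuousLinearMap.comp_apply, hW', hW _ _ hg]
      rw [S.rho_vec hr _ _ _ hf hg, T.rho_vec hr _ _ _ hf hg, hW _ _ hb])
    exact congrArg (fun A => A v) this
  · let U₁ : S.H →L[ℂ] S.H := S.U.toContinuousLinearEquiv.toContinuousLinearMap
    let U₂ : T.H →L[ℂ] T.H := T.U.toContinuousLinearEquiv.toContinuousLinearMap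
    have h₁ : ∀ v, U₁ v = S.U v := fun _ => rfl
    have h₂ : ∀ v, U₂ v = T.U v := fun _ => rfl
    have := S.ext_of_vec (W' ∘L U₁) (U₂ ∘L W') (fun n g hg => by
      simp only [ContinuousLinearMap.comp_apply, hW', hW _ _ hg, h₁, h₂]
      cases n with
      | zero =>
        rw [S.U_vec_zero hr hm₀ _ hg, T.U_vec_zero hr hm₀ _ hg, hW _ _ ((hg.comp hr).mul hm₀)]
      | succ n => rw [U_vec_succ, U_vec_succ, hW _ _ hg])
    exact congrArg (fun A => A v) this
  · simpa [vec, S.rep_one, T.rep_one] using hW 0 1 BddMeasC.one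

end CovariantSystem

end Uniqueness

section Transfer

variable {X : Type} {r : X → X}

theorem transfer_eq_sum (hfin : ∀ x, (r ⁻¹' {x}).Finite) (f : X → ℝ) (x : X) :
    transfer r f x = ((hfin x).toFinset.card : ℝ)⁻¹ * ∑ y ∈ (hfin x).toFinset, f y := by
  have : Fintype (r ⁻¹' {x}) := (hfin x).fintype
  rw [transfer, tsum_fintype, Nat.card_eq_card_finite_toFinset (hfin x)]
  congr 1
  rw [← Finset.sum_coe_sort (hfin x).toFinset]
  exact Fintype.sum_equiv (Equiv.subtypeEquivRight (by simp)) _ _ (fun _ => rfl)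

theorem card_fiber_ne_zero (hsur : Function.Surjective r) (hfin : ∀ x, (r ⁻¹' {x}).Finite)
    (x : X) : ((hfin x).toFinset.card : ℝ) ≠ 0 := by
  obtain ⟨y, hy⟩ := hsur x
  have : y ∈ (hfin x).toFinset := by simpa using hy
  exact_mod_cast Finset.card_ne_zero_of_mem this

theorem transfer_mono (hfin : ∀ x, (r ⁻¹' {x}).Finite) {f g : X → ℝ} (hfg : ∀ x, f x ≤ g x)
    (x : X) : transfer r f x ≤ transfer r g x := by
  rw [transfer_eq_sum hfin, transfer_eq_sum hfin]
  gcongr with y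
  exact hfg y

theorem transfer_const (hsur : Function.Surjective r) (hfin : ∀ x, (r ⁻¹' {x}).Finite) (c : ℝ)
    (x : X) : transfer r (fun _ => c) x = c := by
  rw [transfer_eq_sum hfin]
  have := card_fiber_ne_zero hsur hfin x
  simp only [Finset.sum_const, nsmul_eq_mul]
  field_simp

theorem transfer_add (hfin : ∀ x, (r ⁻¹' {x}).Finite) (f g : X → ℝ)
    (x : X) : transfer r (fun y => f y + g y) x = transfer r f x + transfer r g x := by
  simp only [transfer_eq_sum hfin, Finset.sum_add_distrib, mul_add]

theorem transfer_comp_mul (hfin : ∀ x, (r ⁻¹' {x}).Finite) (f g : X → ℝ)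
    (x : X) : transfer r (fun y => g (r y) * f y) x = g x * transfer r f x := by
  simp only [transfer_eq_sum hfin]
  have : ∑ y ∈ (hfin x).toFinset, g (r y) * f y = ∑ y ∈ (hfin x).toFinset, g x * f y := by
    refine Finset.sum_congr rfl fun y hy => ?_
    have : r y = x := by simpa using hy
    rw [this]
  rw [this, ← Finset.mul_sum]
  ring

theorem transfer_tendsto (hfin : ∀ x, (r ⁻¹' {x}).Finite) (f : ℕ → X → ℝ) (g : X → ℝ)
    (hf : ∀ x, Filter.Tendsto (fun n => f n x) Filter.atTop (nhds (g x))) (x : X) :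
    Filter.Tendsto (fun n => transfer r (f n) x) Filter.atTop (nhds (transfer r g x)) := by
  simp only [transfer_eq_sum hfin]
  exact (tendsto_finsetSum _ fun y _ => hf y).const_mul _

variable [MeasurableSpace X] {μ : Measure X} [IsProbabilityMeasure μ]

/-- Strong invariance forces a.e. measurability of the transferred function. -/
theorem transfer_aesm (hsur : Function.Surjective r) (hfin : ∀ x, (r ⁻¹' {x}).Finite)
    (hinv : StronglyInvariant r μ) {f : X → ℝ} (hf : BddMeasurable f) :
    MeasureTheory.AEStronglyMeasurable (transfer r f) μ := by
  by_contra hcon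
  obtain ⟨hfm, C, hC⟩ := hf
  have h1 : BddMeasurable (fun y => f y + 1) :=
    ⟨hfm.add_const 1, C + 1, fun x => (abs_add_le _ _).trans (by simpa using hC x)⟩
  have hcon' : ¬ MeasureTheory.AEStronglyMeasurable (transfer r (fun y => f y + 1)) μ := by
    intro hh
    apply hcon
    have := hh.sub (MeasureTheory.aestronglyMeasurable_const (b := (1 : ℝ)))
    refine this.congr (Filter.Eventually.of_forall fun x => ?_)
    simp [transfer_add hfin, transfer_const hsur hfin]
  have e1 := hinv f ⟨hfm, C, hC⟩
  have e2 := hinv _ h1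
  rw [MeasureTheory.integral_non_aestronglyMeasurable hcon] at e1
  rw [MeasureTheory.integral_non_aestronglyMeasurable hcon', MeasureTheory.integral_add] at e2
  · simp [e1] at e2
  · exact Integrable.of_bound hfm.aestronglyMeasurable C (Filter.Eventually.of_forall hC)
  · exact MeasureTheory.integrable_const _

theorem transfer_lintegral (hsur : Function.Surjective r) (hfin : ∀ x, (r ⁻¹' {x}).Finite)
    (hinv : StronglyInvariant r μ) {f : X → ℝ} (hf : BddMeasurable f) (h0 : ∀ x, 0 ≤ f x) :
    ∫⁻ x, ENNReal.ofReal (f x) ∂μ = ∫⁻ x, ENNReal.ofReal (transfer r f x) ∂μ := by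
  have hT := transfer_aesm hsur hfin hinv hf
  have e := hinv f hf
  obtain ⟨hfm, C, hC⟩ := hf
  have hT0 : ∀ x, 0 ≤ transfer r f x := fun x => by
    have := transfer_mono hfin h0 x
    rwa [transfer_const hsur hfin] at this
  have hTC : ∀ x, transfer r f x ≤ C := fun x => by
    have := transfer_mono hfin (fun x => (le_abs_self _).trans (hC x)) x
    rwa [transfer_const hsur hfin] at this
  rw [← MeasureTheory.ofReal_integral_eq_lintegral_ofReal,
    ← MeasureTheory.ofReal_integral_eq_lintegral_ofReal, e]
  · refine Integrable.of_bound hT C (Filter.Eventually.of_forall fun x => ?_)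
    rw [Real.norm_of_nonneg (hT0 x)]; exact hTC x
  · exact Filter.Eventually.of_forall hT0
  · exact Integrable.of_bound hfm.aestronglyMeasurable C (Filter.Eventually.of_forall hC)
  · exact Filter.Eventually.of_forall h0

theorem measurePreserving_of_stronglyInvariant (hr : Measurable r)
    (hsur : Function.Surjective r) (hfin : ∀ x, (r ⁻¹' {x}).Finite)
    (hinv : StronglyInvariant r μ) : MeasureTheory.MeasurePreserving r μ μ := by
  refine ⟨hr, ?_⟩
  ext A hA
  rw [MeasureTheory.Measure.map_apply hr hA]
  have hb : BddMeasurable (fun y => A.indicator (fun _ => (1 : ℝ)) (r y) * 1) := by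
    refine ⟨((measurable_const.indicator hA).comp hr).mul_const 1, 1, fun x => ?_⟩
    by_cases hx : r x ∈ A <;> simp [hx]
  have e := transfer_lintegral hsur hfin hinv hb (fun x => by by_cases hx : r x ∈ A <;> simp [hx])
  simp only [transfer_comp_mul hfin, transfer_const hsur hfin] at e
  rw [← MeasureTheory.lintegral_indicator_one hA,
    ← MeasureTheory.lintegral_indicator_one (hr hA)]
  convert e using 2
  · funext x; by_cases hx : r x ∈ A <;> simp [hx]
  · funext x; by_cases hx : x ∈ A <;> simp [hx]

theorem lintegral_ruelle (hr : Measurable r)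
    (hsur : Function.Surjective r) (hfin : ∀ x, (r ⁻¹' {x}).Finite)
    (hinv : StronglyInvariant r μ) {m₀ : X → ℂ} (hm₀ : BddMeasC m₀)
    {h : X → ℝ} (hmeas : Measurable h) (hpos : ∀ x, 0 ≤ h x)
    (hfix : ∀ᵐ x ∂μ, ruelle r (fun y => ‖m₀ y‖ ^ 2) h x = h x) {A : Set X}
    (hA : MeasurableSet A) :
    ∫⁻ x in r ⁻¹' A, ENNReal.ofReal (‖m₀ x‖ ^ 2 * h x) ∂μ = ∫⁻ x in A, ENNReal.ofReal (h x) ∂μ := by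
  obtain ⟨hm, C, hC⟩ := hm₀
  let a : X → ℝ := A.indicator (fun _ => (1 : ℝ))
  have ha : Measurable a := measurable_const.indicator hA
  have ha0 : ∀ x, 0 ≤ a x := fun x => Set.indicator_nonneg (by simp) x
  have ha1 : ∀ x, a x ≤ 1 := fun x => Set.indicator_le_self' (by simp) x |>.trans le_rfl
  let g : ℕ → X → ℝ := fun n x => ‖m₀ x‖ ^ 2 * min (h x) n
  have hg0 : ∀ n x, 0 ≤ g n x := fun n x =>
    mul_nonneg (by positivity) (le_min (hpos x) (by positivity))
  have hgm : ∀ n, Measurable (g n) := fun n => (hm.norm.pow_const 2).mul (hmeas.min measurable_const)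
  have hgmono : ∀ x, Monotone (fun n => g n x) := fun x n k hnk => by
    dsimp [g]; gcongr
  have hgC : ∀ n x, g n x ≤ C ^ 2 * n := fun n x => by
    have := hC x
    exact mul_le_mul (by gcongr) (min_le_right _ _) (le_min (hpos x) (by positivity)) (by positivity)
  have hgl : ∀ x, Filter.Tendsto (fun n => g n x) Filter.atTop (nhds (‖m₀ x‖ ^ 2 * h x)) := by
    intro x
    apply tendsto_const_nhds.congr'
    filter_upwards [Filter.eventually_ge_atTop ⌈h x⌉₊] with n hn
    have : h x ≤ n := (Nat.le_ceil _).trans (by exact_mod_cast hn)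
    simp [g, this]
  let F : ℕ → X → ℝ := fun n x => a (r x) * g n x
  have hF : ∀ n, BddMeasurable (F n) := fun n => by
    refine ⟨(ha.comp hr).mul (hgm n), C ^ 2 * n, fun x => ?_⟩
    rw [abs_of_nonneg (mul_nonneg (ha0 _) (hg0 _ _))]
    exact (mul_le_of_le_one_left (hg0 _ _) (ha1 _)).trans (hgC n x)
  have hF0 : ∀ n x, 0 ≤ F n x := fun n x => mul_nonneg (ha0 _) (hg0 _ _)
  have key : ∀ n, _ := fun n => transfer_lintegral hsur hfin hinv (hF n) (hF0 n)
  have L1 : Filter.Tendsto (fun n => ∫⁻ x, ENNReal.ofReal (F n x) ∂μ) Filter.atTop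
      (nhds (∫⁻ x, ENNReal.ofReal (a (r x) * (‖m₀ x‖ ^ 2 * h x)) ∂μ)) := by
    apply MeasureTheory.lintegral_tendsto_of_tendsto_of_monotone
    · intro n; exact (hF n).1.ennreal_ofReal.aemeasurable
    · refine Filter.Eventually.of_forall fun x n k hnk => ENNReal.ofReal_le_ofReal ?_
      exact mul_le_mul_of_nonneg_left (hgmono x hnk) (ha0 _)
    · exact Filter.Eventually.of_forall fun x =>
        ENNReal.tendsto_ofReal ((hgl x).const_mul _)
  have L2 : Filter.Tendsto (fun n => ∫⁻ x, ENNReal.ofReal (transfer r (F n) x) ∂μ) Filter.atTop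
      (nhds (∫⁻ x, ENNReal.ofReal (a x * h x) ∂μ)) := by
    apply MeasureTheory.lintegral_tendsto_of_tendsto_of_monotone
    · intro n; exact (transfer_aesm hsur hfin hinv (hF n)).aemeasurable.ennreal_ofReal
    · refine Filter.Eventually.of_forall fun x n k hnk => ENNReal.ofReal_le_ofReal ?_
      exact transfer_mono hfin (fun y => mul_le_mul_of_nonneg_left (hgmono y hnk) (ha0 _)) x
    · filter_upwards [hfix] with x hx
      apply ENNReal.tendsto_ofReal
      simp only [F, transfer_comp_mul hfin]
      apply Filter.Tendsto.const_mul
      have := transfer_tendsto hfin _ _ hgl x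
      rwa [show transfer r (fun x => ‖m₀ x‖ ^ 2 * h x) x = h x from hx] at this
  simp only [key] at L1
  have e := tendsto_nhds_unique L1 L2
  rw [← MeasureTheory.lintegral_indicator hA, ← MeasureTheory.lintegral_indicator (hr hA)]
  convert e using 2
  · funext x; by_cases hx : r x ∈ A <;> simp [hx, a]
  · funext x; by_cases hx : x ∈ A <;> simp [hx, a]

/-- The measure `h dμ`. -/
noncomputable def hMeasure (μ : Measure X) (h : X → ℝ) : Measure X :=
  μ.withDensity fun x => ENNReal.ofReal (h x)

theorem lintegral_hMeasure (hr : Measurable r)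
    (hsur : Function.Surjective r) (hfin : ∀ x, (r ⁻¹' {x}).Finite)
    (hinv : StronglyInvariant r μ) {m₀ : X → ℂ} (hm₀ : BddMeasC m₀)
    {h : X → ℝ} (hmeas : Measurable h) (hpos : ∀ x, 0 ≤ h x)
    (hfix : ∀ᵐ x ∂μ, ruelle r (fun y => ‖m₀ y‖ ^ 2) h x = h x) {g : X → ENNReal}
    (hg : Measurable g) :
    ∫⁻ x, ‖m₀ x‖ₑ ^ 2 * g (r x) ∂(hMeasure μ h) = ∫⁻ x, g x ∂(hMeasure μ h) := by
  have hden : Measurable fun x => ‖m₀ x‖ₑ ^ 2 := hm₀.1.enorm.pow_const 2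
  have hm : ((hMeasure μ h).withDensity fun x => ‖m₀ x‖ₑ ^ 2).map r = hMeasure μ h := by
    ext A hA
    rw [MeasureTheory.Measure.map_apply hr hA, MeasureTheory.withDensity_apply _ (hr hA),
      hMeasure, MeasureTheory.withDensity_apply _ hA,
      MeasureTheory.setLIntegral_withDensity_eq_setLIntegral_mul _ hmeas.ennreal_ofReal hden (hr hA),
      ← lintegral_ruelle hr hsur hfin hinv hm₀ hmeas hpos hfix hA]
    congr 1
    funext x
    rw [Pi.mul_apply, mul_comm, ENNReal.ofReal_mul (by positivity),
      ENNReal.ofReal_pow (norm_nonneg _), ofReal_norm]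
  conv_rhs => rw [← hm, MeasureTheory.lintegral_map hg hr]
  exact (MeasureTheory.lintegral_withDensity_eq_lintegral_mul _ hden (hg.comp hr)).symm

end Transfer

section Dilation

open scoped InnerProduct

variable {E : Type} [NormedAddCommGroup E] [InnerProductSpace ℂ E] [CompleteSpace E]

/-- The adjoint of an isometry. -/
noncomputable def adj (S : E →ₗᵢ[ℂ] E) : E →L[ℂ] E :=
  ContinuousLinearMap.adjoint S.toContinuousLinearMap

theorem inner_adj (S : E →ₗᵢ[ℂ] E) (a b : E) : ⟪a, adj S b⟫_ℂ = ⟪S a, b⟫_ℂ :=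
  ContinuousLinearMap.adjoint_inner_right _ _ _

theorem adj_apply (S : E →ₗᵢ[ℂ] E) (a : E) : adj S (S a) = a := by
  refine ext_inner_left ℂ fun v => ?_
  rw [inner_adj, S.inner_map_map]

/-- The layers of the dilation space. -/
noncomputable def layer (S : E →ₗᵢ[ℂ] E) : ℕ → Submodule ℂ E
  | 0 => ⊤
  | _ + 1 => (adj S).ker

theorem mem_layer_zero (S : E →ₗᵢ[ℂ] E) (e : E) : e ∈ layer S 0 := Submodule.mem_top

theorem mem_layer_succ (S : E →ₗᵢ[ℂ] E) (n : ℕ) (e : E) : e ∈ layer S (n + 1) ↔ adj S e = 0 :=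
  Iff.rfl

instance layer_complete (S : E →ₗᵢ[ℂ] E) (n : ℕ) : CompleteSpace (layer S n) := by
  apply IsComplete.completeSpace_coe
  apply IsClosed.isComplete
  cases n with
  | zero => exact isClosed_univ
  | succ n => exact (adj S).isClosed_ker

/-- The space of the minimal unitary dilation of the isometry `S`. -/
abbrev DilSpace (S : E →ₗᵢ[ℂ] E) : Type := lp (fun n => layer S n) 2

variable {S : E →ₗᵢ[ℂ] E}

theorem memlp_iff_summable (x : ∀ n, layer S n) :
    Memℓp x 2 ↔ Summable fun n => ‖(x n : E)‖ ^ 2 := by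
  rw [memℓp_gen_iff (by norm_num)]
  simp

theorem dil_norm_sq (x : DilSpace S) : ‖x‖ ^ 2 = ∑' n, ‖(x n : E)‖ ^ 2 := by
  have := lp.norm_rpow_eq_tsum (p := 2) (by norm_num) x
  simpa using this

theorem dil_summable (x : DilSpace S) : Summable fun n => ‖(x n : E)‖ ^ 2 :=
  (memlp_iff_summable x).1 (lp.memℓp x)

theorem dil_ext {x y : DilSpace S} (hxy : ∀ n, (x n : E) = y n) : x = y :=
  lp.ext (funext fun n => Subtype.ext (hxy n))

/-- Underlying function of the unitary. -/
noncomputable def dilFun (x : ∀ n, layer S n) : ∀ n, layer S n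
  | 0 => ⟨S (x 0 : E) + (x 1 : E), mem_layer_zero S _⟩
  | n + 1 => ⟨(x (n + 2) : E), (x (n + 2)).2⟩

/-- Underlying function of the inverse of the unitary. -/
noncomputable def dilInv (x : ∀ n, layer S n) : ∀ n, layer S n
  | 0 => ⟨adj S (x 0 : E), mem_layer_zero S _⟩
  | 1 => ⟨(x 0 : E) - S (adj S (x 0 : E)), by
      rw [mem_layer_succ, map_sub, adj_apply, sub_self]⟩
  | n + 2 => ⟨(x (n + 1) : E), (x (n + 1)).2⟩

theorem dilFun_mem (x : DilSpace S) : Memℓp (dilFun (S := S) x) 2 := by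
  rw [memlp_iff_summable, ← summable_nat_add_iff 1]
  exact (summable_nat_add_iff 2).2 (dil_summable x)

theorem dilInv_mem (x : DilSpace S) : Memℓp (dilInv (S := S) x) 2 := by
  rw [memlp_iff_summable, ← summable_nat_add_iff 2]
  exact (summable_nat_add_iff 1).2 (dil_summable x)

theorem layer_one_orth (a : E) (b : layer S 1) : ⟪S a, (b : E)⟫_ℂ = 0 := by
  rw [← inner_adj, (mem_layer_succ S 0 _).1 b.2, inner_zero_right]

/-- The unitary dilation of `S`. -/
noncomputable def dilU (S : E →ₗᵢ[ℂ] E) : DilSpace S ≃ₗᵢ[ℂ] DilSpace S where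
  toFun x := ⟨dilFun x, dilFun_mem x⟩
  invFun x := ⟨dilInv x, dilInv_mem x⟩
  map_add' x y := by
    apply dil_ext
    rintro (_ | n)
    · simp [dilFun, add_add_add_comm]
      rfl
    · simp [dilFun]
      rfl
  map_smul' c x := by
    apply dil_ext
    rintro (_ | n)
    · simp [dilFun]
    · simp [dilFun]
  left_inv x := by
    have h1 : adj S (x 1 : E) = 0 := (mem_layer_succ S 0 _).1 (x 1).2
    apply dil_ext
    rintro (_ | _ | n)
    · simp [dilFun, dilInv, adj_apply, h1]
    · simp [dilFun, dilInv, adj_apply, h1]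
    · simp [dilFun, dilInv]
  right_inv x := by
    apply dil_ext
    rintro (_ | n)
    · simp [dilFun, dilInv]
    · simp [dilFun, dilInv]
  norm_map' x := by
    have hs := dil_summable x
    have hs' := (summable_nat_add_iff 1).2 hs
    rw [← sq_eq_sq₀ (norm_nonneg _) (norm_nonneg _), dil_norm_sq, dil_norm_sq,
      Summable.tsum_eq_zero_add (dil_summable _), hs.tsum_eq_zero_add, hs'.tsum_eq_zero_add,
      ← add_assoc]
    congr 1
    have := norm_add_sq_eq_norm_sq_add_norm_sq_of_inner_eq_zero (𝕜 := ℂ) (S (x 0 : E)) (x 1 : E)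
      (layer_one_orth _ _)
    simp only [← pow_two, S.norm_map] at this
    exact this

theorem dilU_zero (x : DilSpace S) : (dilU S x 0 : E) = S (x 0 : E) + (x 1 : E) := rfl

theorem dilU_succ (x : DilSpace S) (n : ℕ) : (dilU S x (n + 1) : E) = x (n + 2) := rfl

/-- Condition for a sequence of operators to define a diagonal operator. -/
def DiagOK (S : E →ₗᵢ[ℂ] E) (T : ℕ → E →L[ℂ] E) : Prop :=
  (∃ C : ℝ, ∀ n e, ‖T n e‖ ≤ C * ‖e‖) ∧ ∀ n, ∀ e ∈ layer S n, T n e ∈ layer S n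

/-- Diagonal operators. -/
theorem diagAux (S : E →ₗᵢ[ℂ] E) (T : ℕ → E →L[ℂ] E) (hT : DiagOK S T) :
    ∃ A : DilSpace S →L[ℂ] DilSpace S, ∀ x n, (A x n : E) = T n (x n) := by
  obtain ⟨⟨C, hC⟩, hD⟩ := hT
  have hle : ∀ (x : DilSpace S) n, ‖T n (x n)‖ ^ 2 ≤ C ^ 2 * ‖(x n : E)‖ ^ 2 := fun x n => by
    rw [← mul_pow]
    exact pow_le_pow_left₀ (norm_nonneg _) (hC n _) 2
  have hs : ∀ x : DilSpace S, Summable fun n => C ^ 2 * ‖(x n : E)‖ ^ 2 := fun x =>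
    (dil_summable x).mul_left _
  let A : DilSpace S →ₗ[ℂ] DilSpace S :=
    { toFun := fun x => ⟨fun n => ⟨T n (x n), hD n _ (x n).2⟩,
        (memlp_iff_summable _).2 (Summable.of_nonneg_of_le (fun _ => by positivity)
          (hle x) (hs x))⟩
      map_add' := fun x y => dil_ext fun n => by simp; rfl
      map_smul' := fun c x => dil_ext fun n => by simp }
  refine ⟨A.mkContinuous |C| fun x => ?_, fun x n => rfl⟩
  rw [← sq_le_sq₀ (norm_nonneg _) (by positivity), mul_pow, sq_abs, dil_norm_sq, dil_norm_sq,
    ← tsum_mul_left]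
  exact (dil_summable (A x)).tsum_le_tsum (hle x) (hs x)

open Classical in
/-- Diagonal operators, zero when not defined. -/
noncomputable def diag (S : E →ₗᵢ[ℂ] E) (T : ℕ → E →L[ℂ] E) : DilSpace S →L[ℂ] DilSpace S :=
  if hT : DiagOK S T then (diagAux S T hT).choose else 0

theorem diag_apply {T : ℕ → E →L[ℂ] E} (hT : DiagOK S T) (x : DilSpace S) (n : ℕ) :
    (diag S T x n : E) = T n (x n) := by
  rw [diag, dif_pos hT]
  exact (diagAux S T hT).choose_spec x n

/-- Cyclicity of the bottom layer. -/
theorem dil_closed_eq_top (K : Submodule ℂ (DilSpace S)) (hK : IsClosed (K : Set (DilSpace S)))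
    (hU : ∀ x ∈ K, (dilU S).symm x ∈ K)
    (h0 : ∀ e : layer S 0, (lp.single 2 0 e : DilSpace S) ∈ K) : K = ⊤ := by
  have h1 : ∀ d : layer S 1, (lp.single 2 1 d : DilSpace S) ∈ K := by
    intro d
    have := hU _ (h0 ⟨(d : E), mem_layer_zero S _⟩)
    convert this
    rw [LinearIsometryEquiv.eq_symm_apply]
    apply dil_ext
    rintro (_ | n)
    · simp [dilU_zero]
    · rw [dilU_succ]
      simp [lp.single_apply]
  have h2 : ∀ n, ∀ d : layer S (n + 1), (lp.single 2 (n + 1) d : DilSpace S) ∈ K := by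
    intro n
    induction n with
    | zero => exact h1
    | succ n ih =>
      intro d
      have := hU _ (ih ⟨(d : E), d.2⟩)
      convert this
      rw [LinearIsometryEquiv.eq_symm_apply]
      apply dil_ext
      rintro (_ | k)
      · simp [dilU_zero, lp.single_apply]
      · rw [dilU_succ]
        by_cases hk : k = n
        · subst hk
          simp
        · simp [lp.single_apply, hk]
  rw [eq_top_iff]
  rintro x -
  have hx := lp.hasSum_single (p := 2) (by norm_num) x
  refine hK.mem_of_tendsto hx (Filter.Eventually.of_forall fun s => K.sum_mem fun n _ => ?_)
  cases n with
  | zero => exact h0 _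
  | succ n => exact h2 n _

end Dilation

section Existence

open MeasureTheory (Lp MemLp)

variable {X : Type} [MeasurableSpace X]

theorem BddMeasC.mul_memLp {ν : Measure X} {f : X → ℂ} (hf : BddMeasC f) (e : Lp ℂ 2 ν) :
    MemLp (fun x => f x * e x) 2 ν := by
  obtain ⟨hf, C, hC⟩ := hf
  refine MemLp.of_le_mul (c := C) (MeasureTheory.Lp.memLp e)
    (hf.aestronglyMeasurable.mul (MeasureTheory.Lp.aestronglyMeasurable e))
    (Filter.Eventually.of_forall fun x => ?_)
  rw [norm_mul]
  exact mul_le_mul_of_nonneg_right (hC x) (norm_nonneg _)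

theorem mulOp_aux (ν : Measure X) {f : X → ℂ} (hf : BddMeasC f) :
    ∃ A : Lp ℂ 2 ν →L[ℂ] Lp ℂ 2 ν, ∀ e, A e =ᵐ[ν] fun x => f x * e x := by
  let A : Lp ℂ 2 ν →ₗ[ℂ] Lp ℂ 2 ν :=
    { toFun := fun e => (hf.mul_memLp e).toLp _
      map_add' := fun e e' => by
        rw [← MemLp.toLp_add, MemLp.toLp_eq_toLp_iff]
        filter_upwards [MeasureTheory.Lp.coeFn_add e e'] with x hx
        simp only [hx, Pi.add_apply]; ring
      map_smul' := fun c e => by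
        rw [RingHom.id_apply, ← MemLp.toLp_const_smul, MemLp.toLp_eq_toLp_iff]
        filter_upwards [MeasureTheory.Lp.coeFn_smul c e] with x hx
        simp only [hx, Pi.smul_apply, smul_eq_mul]; ring }
  have hA : ∀ e, A e =ᵐ[ν] fun x => f x * e x := fun e => (hf.mul_memLp e).coeFn_toLp
  obtain ⟨C, hC⟩ := hf.2
  refine ⟨A.mkContinuous C fun e => ?_, hA⟩
  apply MeasureTheory.Lp.norm_le_mul_norm_of_ae_le_mul
  filter_upwards [hA e] with x hx
  rw [hx, norm_mul]
  exact mul_le_mul_of_nonneg_right (hC x) (norm_nonneg _)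

open Classical in
/-- Multiplication operators on `L²(ν)`. -/
noncomputable def mulOp (ν : Measure X) (f : X → ℂ) : Lp ℂ 2 ν →L[ℂ] Lp ℂ 2 ν :=
  if hf : BddMeasC f then (mulOp_aux ν hf).choose else 0

variable {ν : Measure X}

theorem mulOp_coe {f : X → ℂ} (hf : BddMeasC f) (e : Lp ℂ 2 ν) :
    mulOp ν f e =ᵐ[ν] fun x => f x * e x := by
  rw [mulOp, dif_pos hf]
  exact (mulOp_aux ν hf).choose_spec e

theorem mulOp_norm_le {f : X → ℂ} (hf : BddMeasC f) {C : ℝ} (hC : ∀ x, ‖f x‖ ≤ C)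
    (e : Lp ℂ 2 ν) : ‖mulOp ν f e‖ ≤ C * ‖e‖ := by
  apply MeasureTheory.Lp.norm_le_mul_norm_of_ae_le_mul
  filter_upwards [mulOp_coe hf e] with x hx
  rw [hx, norm_mul]
  exact mul_le_mul_of_nonneg_right (hC x) (norm_nonneg _)

theorem mulOp_add {f g : X → ℂ} (hf : BddMeasC f) (hg : BddMeasC g) (e : Lp ℂ 2 ν) :
    mulOp ν (f + g) e = mulOp ν f e + mulOp ν g e := by
  apply MeasureTheory.Lp.ext
  filter_upwards [mulOp_coe (hf.add hg) e, mulOp_coe hf e, mulOp_coe hg e,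
    MeasureTheory.Lp.coeFn_add (mulOp ν f e) (mulOp ν g e)] with x h1 h2 h3 h4
  rw [h4, Pi.add_apply, h1, h2, h3, Pi.add_apply, add_mul]

theorem mulOp_smul (c : ℂ) {f : X → ℂ} (hf : BddMeasC f) (e : Lp ℂ 2 ν) :
    mulOp ν (c • f) e = c • mulOp ν f e := by
  apply MeasureTheory.Lp.ext
  filter_upwards [mulOp_coe (hf.smul c) e, mulOp_coe hf e,
    MeasureTheory.Lp.coeFn_smul c (mulOp ν f e)] with x h1 h2 h4
  rw [h4, Pi.smul_apply, h1, h2, Pi.smul_apply, smul_eq_mul, smul_eq_mul, mul_assoc]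

theorem mulOp_mul {f g : X → ℂ} (hf : BddMeasC f) (hg : BddMeasC g) (e : Lp ℂ 2 ν) :
    mulOp ν (f * g) e = mulOp ν f (mulOp ν g e) := by
  apply MeasureTheory.Lp.ext
  filter_upwards [mulOp_coe (hf.mul hg) e, mulOp_coe hf (mulOp ν g e), mulOp_coe hg e]
    with x h1 h2 h3
  simp [h1, h2, h3, mul_assoc]

theorem mulOp_one (e : Lp ℂ 2 ν) : mulOp ν 1 e = e := by
  apply MeasureTheory.Lp.ext
  filter_upwards [mulOp_coe BddMeasC.one e] with x h1
  simp [h1]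

theorem mulOp_congr {f g : X → ℂ} (hf : BddMeasC f) (hg : BddMeasC g) (hfg : f =ᵐ[ν] g)
    (e : Lp ℂ 2 ν) : mulOp ν f e = mulOp ν g e := by
  apply MeasureTheory.Lp.ext
  filter_upwards [mulOp_coe hf e, mulOp_coe hg e, hfg] with x h1 h2 h3
  simp [h1, h2, h3]

theorem mulOp_star {f : X → ℂ} (hf : BddMeasC f) (a b : Lp ℂ 2 ν) :
    ⟪mulOp ν (star f) a, b⟫_ℂ = ⟪a, mulOp ν f b⟫_ℂ := by
  rw [MeasureTheory.L2.inner_def, MeasureTheory.L2.inner_def]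
  apply MeasureTheory.integral_congr_ae
  filter_upwards [mulOp_coe hf b, mulOp_coe hf.star a] with x h1 h2
  simp only [h1, h2, RCLike.inner_apply, Pi.star_apply, map_mul, starRingEnd_apply, star_star]
  ring

/-- The weighted composition isometry. -/
theorem isom_aux {r : X → X} (hr : Measurable r) {m₀ : X → ℂ} (hm₀ : BddMeasC m₀)
    (hν : ∀ g : X → ENNReal, Measurable g →
      ∫⁻ x, ‖m₀ x‖ₑ ^ 2 * g (r x) ∂ν = ∫⁻ x, g x ∂ν) :
    ∃ S : Lp ℂ 2 ν →ₗᵢ[ℂ] Lp ℂ 2 ν,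
      (∀ e, S e =ᵐ[ν] fun x => m₀ x * e (r x)) ∧
      ∀ P : X → Prop, (∀ᵐ x ∂ν, P x) → ∀ᵐ x ∂ν, m₀ x = 0 ∨ P (r x) := by
  have hae : ∀ P : X → Prop, (∀ᵐ x ∂ν, P x) → ∀ᵐ x ∂ν, m₀ x = 0 ∨ P (r x) := by
    intro P hP
    obtain ⟨N, hPN, hN, hN0⟩ := MeasureTheory.exists_measurable_superset_of_null
      (MeasureTheory.ae_iff.1 hP)
    have h1 := hν (N.indicator 1) (measurable_one.indicator hN)
    rw [MeasureTheory.lintegral_indicator_one hN, hN0] at h1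
    replace h1 := (MeasureTheory.lintegral_eq_zero_iff ((hm₀.1.enorm.pow_const 2).mul
      ((measurable_one.indicator (f := (1 : X → ENNReal)) hN).comp hr))).1 h1
    filter_upwards [h1] with x hx
    by_contra! hcon
    have : r x ∈ N := hPN hcon.2
    simp [this, hcon.1] at hx
  have hsm : ∀ e : Lp ℂ 2 ν, Measurable fun x => m₀ x * e (r x) := fun e =>
    hm₀.1.mul ((MeasureTheory.Lp.stronglyMeasurable e).measurable.comp hr)
  have hnorm : ∀ e : Lp ℂ 2 ν, MeasureTheory.eLpNorm (fun x => m₀ x * e (r x)) 2 ν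
      = MeasureTheory.eLpNorm e 2 ν := by
    intro e
    rw [MeasureTheory.eLpNorm_eq_lintegral_rpow_enorm_toReal (by norm_num) (by norm_num),
      MeasureTheory.eLpNorm_eq_lintegral_rpow_enorm_toReal (by norm_num) (by norm_num)]
    congr 1
    rw [← hν (fun x => ‖e x‖ₑ ^ (2 : ENNReal).toReal)
      ((MeasureTheory.Lp.stronglyMeasurable e).measurable.enorm.pow_const _)]
    congr 1
    funext x
    simp [enorm_mul, mul_pow]
  have hmem : ∀ e : Lp ℂ 2 ν, MemLp (fun x => m₀ x * e (r x)) 2 ν := fun e =>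
    ⟨(hsm e).aestronglyMeasurable, by rw [hnorm]; exact (MeasureTheory.Lp.memLp e).2⟩
  let A : Lp ℂ 2 ν →ₗ[ℂ] Lp ℂ 2 ν :=
    { toFun := fun e => (hmem e).toLp _
      map_add' := fun e e' => by
        rw [← MemLp.toLp_add, MemLp.toLp_eq_toLp_iff]
        filter_upwards [hae _ (MeasureTheory.Lp.coeFn_add e e')] with x hx
        rcases hx with hx | hx
        · simp [hx]
        · simp only [hx, Pi.add_apply]; ring
      map_smul' := fun c e => by
        rw [RingHom.id_apply, ← MemLp.toLp_const_smul, MemLp.toLp_eq_toLp_iff]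
        filter_upwards [hae _ (MeasureTheory.Lp.coeFn_smul c e)] with x hx
        rcases hx with hx | hx
        · simp [hx]
        · simp only [hx, Pi.smul_apply, smul_eq_mul]; ring }
  refine ⟨⟨A, fun e => ?_⟩, fun e => (hmem e).coeFn_toLp, hae⟩
  change ‖(hmem e).toLp _‖ = _
  rw [MeasureTheory.Lp.norm_toLp, hnorm, MeasureTheory.Lp.norm_def]

theorem exists_covariant_system (r : X → X) (hr : Measurable r)
    (hsur : Function.Surjective r) (hfin : ∀ x, (r ⁻¹' {x}).Finite)
    (μ : Measure X) [IsProbabilityMeasure μ] (hinv : StronglyInvariant r μ)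
    (m₀ : X → ℂ) (hm₀ : BddMeasC m₀)
    (h : X → ℝ) (hmeas : Measurable h) (hint : Integrable h μ) (hpos : ∀ x, 0 ≤ h x)
    (hfix : ∀ᵐ x ∂μ, ruelle r (fun y => ‖m₀ y‖ ^ 2) h x = h x) :
    Nonempty (CovariantSystem X r μ m₀ h) := by
  have hmp := measurePreserving_of_stronglyInvariant hr hsur hfin hinv
  let ν : Measure X := hMeasure μ h
  have hac : ν.AbsolutelyContinuous μ := MeasureTheory.withDensity_absolutelyContinuous _ _
  have hfinν : MeasureTheory.IsFiniteMeasure ν := by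
    refine MeasureTheory.isFiniteMeasure_withDensity_ofReal hint.2
  obtain ⟨S, hS, hae⟩ := isom_aux (ν := ν) hr hm₀
    (fun g hg => lintegral_hMeasure hr hsur hfin hinv hm₀ hmeas hpos hfix hg)
  -- commutation
  have hcomm : ∀ f, BddMeasC f → ∀ e, S (mulOp ν f e) = mulOp ν (f ∘ r) (S e) := by
    intro f hf e
    apply MeasureTheory.Lp.ext
    filter_upwards [hS (mulOp ν f e), mulOp_coe (hf.comp hr) (S e), hS e,
      hae _ (mulOp_coe hf e)] with x h1 h2 h3 h4
    rw [h1, h2, h3]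
    rcases h4 with h4 | h4
    · simp [h4]
    · rw [h4]; simp only [Function.comp_apply]; ring
  have hadj : ∀ f, BddMeasC f → ∀ e, adj S (mulOp ν (f ∘ r) e) = mulOp ν f (adj S e) := by
    intro f hf e
    refine ext_inner_left ℂ fun v => ?_
    rw [inner_adj, ← mulOp_star (hf.comp hr), ← mulOp_star hf, inner_adj, hcomm _ hf.star]
    rfl
  let T : (X → ℂ) → ℕ → (Lp ℂ 2 ν →L[ℂ] Lp ℂ 2 ν) := fun f n => mulOp ν (f ∘ r^[n])
  have hb : ∀ f, BddMeasC f → ∀ n, BddMeasC (f ∘ r^[n]) := fun f hf n => hf.comp (hr.iterate n)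
  have hOK : ∀ f, BddMeasC f → DiagOK S (T f) := by
    intro f hf
    obtain ⟨C, hC⟩ := hf.2
    refine ⟨⟨C, fun n e => mulOp_norm_le (hb f hf n) (fun x => hC _) e⟩, ?_⟩
    rintro (_ | n) e he
    · exact mem_layer_zero S _
    · rw [mem_layer_succ] at he ⊢
      have := hadj _ (hb f hf n) e
      rw [he, map_zero] at this
      exact this
  have hρ : ∀ f, BddMeasC f → ∀ x n, (diag S (T f) x n : Lp ℂ 2 ν) = mulOp ν (f ∘ r^[n]) (x n) :=
    fun f hf x n => diag_apply (hOK f hf) x n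
  let one : Lp ℂ 2 ν := MemLp.toLp (fun _ => (1 : ℂ)) (MeasureTheory.memLp_const 1)
  have hone : one =ᵐ[ν] fun _ => (1 : ℂ) := MemLp.coeFn_toLp _
  let φ : DilSpace S := lp.single 2 0 ⟨one, mem_layer_zero S _⟩
  have hφ0 : (φ 0 : Lp ℂ 2 ν) = one := by simp [φ]
  have hφs : ∀ n, (φ (n + 1) : Lp ℂ 2 ν) = 0 := fun n => by simp [φ, lp.single_apply]
  have hρφ : ∀ f (hf : BddMeasC f), diag S (T f) φ
      = lp.single 2 0 ⟨mulOp ν f one, mem_layer_zero S _⟩ := by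
    intro f hf
    apply dil_ext
    intro n
    rw [hρ f hf]
    cases n with
    | zero => rw [hφ0]; simp
    | succ n => rw [hφs]; simp [lp.single_apply]
  have hcov : ∀ f, BddMeasC f → ∀ x, dilU S (diag S (T f) x) = diag S (T (f ∘ r)) (dilU S x) := by
    intro f hf x
    apply dil_ext
    rintro (_ | n)
    · rw [hρ _ (hf.comp hr), dilU_zero, dilU_zero, hρ _ hf, hρ _ hf, map_add]
      simp only [Function.iterate_zero, Function.comp_id, Function.iterate_one]
      rw [hcomm _ hf]
    · rw [hρ _ (hf.comp hr), dilU_succ, dilU_succ, hρ _ hf, Function.comp_assoc,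
        ← Function.iterate_succ']
  refine ⟨{
    H := DilSpace S
    U := dilU S
    ρ := fun f => diag S (T f)
    φ := φ
    rep_add := ?_
    rep_smul := ?_
    rep_mul := ?_
    rep_one := ?_
    rep_star := ?_
    rep_ae := ?_
    covariant := ?_
    vector_state := ?_
    scaling := ?_
    cyclic := ?_ }⟩
  · intro f g hf hg
    ext1 x
    refine dil_ext fun n => ?_
    rw [hρ _ (hf.add hg)]
    have := mulOp_add (hb f hf n) (hb g hg n) (x n : Lp ℂ 2 ν)
    simp only [ContinuousLinearMap.add_apply, lp.coeFn_add, PreLp.add_apply, Pi.add_apply,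
      Submodule.coe_add, hρ _ hf, hρ _ hg]
    exact this
  · intro c f hf
    ext1 x
    refine dil_ext fun n => ?_
    rw [hρ _ (hf.smul c)]
    have := mulOp_smul c (hb f hf n) (x n : Lp ℂ 2 ν)
    simp only [ContinuousLinearMap.smul_apply, lp.coeFn_smul, Pi.smul_apply,
      Submodule.coe_smul, hρ _ hf]
    exact this
  · intro f g hf hg
    ext1 x
    refine dil_ext fun n => ?_
    rw [hρ _ (hf.mul hg)]
    have := mulOp_mul (hb f hf n) (hb g hg n) (x n : Lp ℂ 2 ν)
    simp only [ContinuousLinearMap.mul_apply, hρ _ hf, hρ _ hg]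
    exact this
  · ext1 x
    refine dil_ext fun n => ?_
    rw [hρ _ BddMeasC.one]
    exact mulOp_one _
  · intro f hf
    rw [ContinuousLinearMap.star_eq_adjoint, ContinuousLinearMap.eq_adjoint_iff]
    intro x y
    rw [lp.inner_eq_tsum, lp.inner_eq_tsum]
    congr 1
    funext n
    rw [Submodule.coe_inner, Submodule.coe_inner, hρ _ hf, hρ _ hf.star]
    exact mulOp_star (hb f hf n) _ _
  · intro f g hf hg hfg
    ext1 x
    refine dil_ext fun n => ?_
    rw [hρ _ hf, hρ _ hg]
    refine mulOp_congr (hb f hf n) (hb g hg n) ?_ _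
    apply hac.ae_le
    exact (hmp.iterate n).quasiMeasurePreserving.ae_eq_comp hfg
  · intro f hf v
    rw [hcov f hf, LinearIsometryEquiv.apply_symm_apply]
  · intro f hf
    rw [hρφ f hf, lp.inner_single_left]
    simp only [lp.single_apply_self, Submodule.coe_inner, hφ0]
    rw [MeasureTheory.L2.inner_def]
    have e1 : ∫ x, f x * (h x : ℂ) ∂μ = ∫ x, f x ∂ν := by
      rw [show ν = μ.withDensity fun x => ENNReal.ofReal (h x) from rfl,
        integral_withDensity_eq_integral_toReal_smul hmeas.ennreal_ofReal
          (Filter.Eventually.of_forall fun x => ENNReal.ofReal_lt_top)]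
      congr 1
      funext x
      rw [ENNReal.toReal_ofReal (hpos x), Complex.real_smul, mul_comm]
    rw [e1]
    apply MeasureTheory.integral_congr_ae
    filter_upwards [hone, mulOp_coe hf one] with x h1 h2
    simp [h1, h2]
  · rw [hρφ _ hm₀]
    apply dil_ext
    rintro (_ | n)
    · rw [dilU_zero, hφ0, hφs]
      simp only [lp.single_apply_self, add_zero]
      apply MeasureTheory.Lp.ext
      filter_upwards [hS one, mulOp_coe hm₀ one, hae _ hone, hone] with x h1 h2 h3 h4
      rw [h1, h2, h4]
      rcases h3 with h3 | h3
      · simp [h3]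
      · rw [h3]
    · rw [dilU_succ, hφs]
      simp [lp.single_apply]
  · apply dil_closed_eq_top
    · exact Submodule.isClosed_topologicalClosure _
    · intro x hx
      have hcl := (dilU S).symm.continuous
      have : (dilU S).symm '' closure (Submodule.span ℂ {v : DilSpace S | ∃ (n : ℕ) (f : X → ℂ),
          BddMeasC f ∧ v = (⇑(dilU S).symm)^[n] (diag S (T f) φ)} : Set (DilSpace S)) ⊆ _ :=
        image_closure_subset_closure_image hcl
      refine closure_mono ?_ (this ⟨x, hx, rfl⟩)
      rintro _ ⟨y, hy, rfl⟩
      have hmap : Submodule.span ℂ {v : DilSpace S | ∃ (n : ℕ) (f : X → ℂ),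
          BddMeasC f ∧ v = (⇑(dilU S).symm)^[n] (diag S (T f) φ)} ≤
          (Submodule.span ℂ {v : DilSpace S | ∃ (n : ℕ) (f : X → ℂ),
          BddMeasC f ∧ v = (⇑(dilU S).symm)^[n] (diag S (T f) φ)}).comap
          (dilU S).symm.toLinearEquiv.toLinearMap := by
        rw [Submodule.span_le]
        rintro _ ⟨n, f, hf, rfl⟩
        exact Submodule.subset_span ⟨n + 1, f, hf, (Function.iterate_succ_apply' _ _ _).symm⟩
      exact hmap hy
    · rintro ⟨e, he⟩
      set K := (Submodule.span ℂ {v : DilSpace S | ∃ (n : ℕ) (f : X → ℂ),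
          BddMeasC f ∧ v = (⇑(dilU S).symm)^[n] (diag S (T f) φ)}).topologicalClosure with hK
      have hKc : IsClosed (K : Set (DilSpace S)) := Submodule.isClosed_topologicalClosure _
      let J : Lp ℂ 2 ν → DilSpace S := fun e => lp.single 2 0 ⟨e, mem_layer_zero S e⟩
      have hJ : Continuous J := by
        refine (lp.isometry_single (E := fun n => layer S n) (p := 2) 0).continuous.comp ?_
        exact continuous_id.subtype_mk _
      have hJadd : ∀ a b, J (a + b) = J a + J b := fun a b =>
        lp.single_add (E := fun n => layer S n) 2 0 (⟨a, mem_layer_zero S a⟩ : layer S 0)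
          (⟨b, mem_layer_zero S b⟩ : layer S 0)
      change J e ∈ K
      refine MeasureTheory.Lp.induction (by norm_num) (motive := fun e => J e ∈ K) ?_ ?_ ?_ e
      · intro c A hA hνA
        have hbd : BddMeasC (A.indicator fun _ => c) := by
          refine ⟨measurable_const.indicator hA, ‖c‖, fun x => ?_⟩
          exact norm_indicator_le_norm_self _ _
        have : J (MeasureTheory.Lp.simpleFunc.indicatorConst 2 hA hνA.ne c : Lp ℂ 2 ν)
            = diag S (T (A.indicator fun _ => c)) φ := by
          rw [hρφ _ hbd]
          simp only [J]
          congr 2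
          apply MeasureTheory.Lp.ext
          rw [MeasureTheory.Lp.simpleFunc.coe_indicatorConst]
          filter_upwards [mulOp_coe hbd one, hone,
            MeasureTheory.indicatorConstLp_coeFn (p := 2) (hs := hA) (hμs := hνA.ne) (c := c)]
            with x h1 h2 h3
          rw [h1, h2, h3, mul_one]
        rw [this]
        apply Submodule.le_topologicalClosure
        apply Submodule.subset_span
        exact ⟨0, _, hbd, rfl⟩
      · intro f g hf hg _ hfK hgK
        rw [hJadd]
        exact K.add_mem hfK hgK
      · exact hKc.preimage hJ

end Existence

/-- Corollary 4.4: for a strongly `r`-invariant probability measure `μ`, `m₀ ∈ L^∞(X)` and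
`h ≥ 0` in `L¹(X,μ)` with `R_{|m₀|²} h = h` a.e., there exists a covariant system
`(H, U, π, φ)` associated to `m₀` and `h`, unique up to intertwining isomorphism. -/
theorem exists_unique_covariant_system_Linfty
    (X : Type) [MeasurableSpace X] (r : X → X) (hr : Measurable r)
    (hsur : Function.Surjective r) (hfin : ∀ x, (r ⁻¹' {x}).Finite)
    (μ : Measure X) [IsProbabilityMeasure μ] (hinv : StronglyInvariant r μ)
    (m₀ : X → ℂ) (hm₀ : BddMeasC m₀)
    (h : X → ℝ) (hmeas : Measurable h) (hint : Integrable h μ) (hpos : ∀ x, 0 ≤ h x)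
    (hfix : ∀ᵐ x ∂μ, ruelle r (fun y => ‖m₀ y‖ ^ 2) h x = h x) :
    Nonempty (CovariantSystem X r μ m₀ h) ∧
      ∀ S T : CovariantSystem X r μ m₀ h,
        ∃ W : S.H ≃ₗᵢ[ℂ] T.H,
          (∀ (f : X → ℂ), BddMeasC f → ∀ v : S.H, W (S.ρ f v) = T.ρ f (W v)) ∧
          (∀ v : S.H, W (S.U v) = T.U (W v)) ∧ W S.φ = T.φ := by
  exact ⟨exists_covariant_system r hr hsur hfin μ hinv m₀ hm₀ h hmeas hint hpos hfix,
    fun S T => S.unique T hr hm₀⟩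
end

section
/- Let (X,𝔅) be a measurable space, r : X → X measurable, onto and finite-to-one, μ a strongly r-invariant probability measure on X, and m₀ ∈ L^∞(X). Define (Rξ)(x) = (1/#r⁻¹(x)) Σ_{y : r(y)=x} |m₀(y)|² ξ(y) for ξ ∈ L¹(X,μ). If h ∈ L¹(X,μ), h ≥ 0, and Rh = h, then there exists a unique measure μ̂ on (X_∞(r), 𝔅_∞) such that the pushforward μ̂∘θ_n⁻¹ equals the measure ω_n for every n ≥ 0, where ω_n(f) = ∫_X Rⁿ(f h) dμ for bounded measurable f on X. Moreover, identifying a function f on X with f∘θ₀ on X_∞(r), the measure μ̂ satisfies d(μ̂∘r̂)/dμ̂ = |m₀|² (i.e., μ̂∘r̂ ≪ μ̂ with Radon–Nikodym derivative |m₀∘θ₀|²). -/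
open MeasureTheory
open scoped ENNReal

/-- The projective limit (solenoid) of the system `X ← X ← X ← ⋯` under `r`. -/
def Xinf {X : Type} (r : X → X) : Set (ℕ → X) := {x | ∀ n, r (x (n + 1)) = x n}

/-- Projection onto the `n`-th coordinate. -/
def theta {X : Type} (r : X → X) (n : ℕ) (xh : Xinf r) : X := (xh : ℕ → X) n

/-- The inverse of the induced automorphism `r̂`: `(x₀,x₁,…) ↦ (x₁,x₂,…)`.
Note `(μ̂ ∘ r̂)(E) = μ̂(r̂(E)) = (μ̂.map rhatInv)(E)`. -/
def rhatInv {X : Type} (r : X → X) (xh : Xinf r) : Xinf r :=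
  ⟨fun n => (xh : ℕ → X) (n + 1), fun n => xh.2 (n + 1)⟩

/-! ### Helper lemmas: the transfer operator on extended nonnegative functions -/

namespace ProjLim

open Filter Topology

/-- Transfer operator on `ℝ≥0∞`-valued functions. -/
noncomputable def T {X : Type} (r : X → X) (f : X → ℝ≥0∞) (x : X) : ℝ≥0∞ :=
  (Nat.card (r ⁻¹' {x}) : ℝ≥0∞)⁻¹ * ∑' y : r ⁻¹' {x}, f y

section basic
variable {X : Type} {r : X → X}

lemma card_ne (hsur : Function.Surjective r) (hfin : ∀ x, (r ⁻¹' {x}).Finite) (x : X) :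
    Nat.card (r ⁻¹' {x}) ≠ 0 := by
  have : Finite (r ⁻¹' {x}) := hfin x
  have : Nonempty (r ⁻¹' {x}) := by
    obtain ⟨y, hy⟩ := hsur x
    exact ⟨⟨y, hy⟩⟩
  exact Nat.card_ne_zero.2 ⟨inferInstance, inferInstance⟩

lemma T_mono {f g : X → ℝ≥0∞} {x : X} (hfg : ∀ y, r y = x → f y ≤ g y) :
    T r f x ≤ T r g x := by
  unfold T
  gcongr with y
  exact hfg y y.2

lemma T_congr {f g : X → ℝ≥0∞} {x : X} (hfg : ∀ y, r y = x → f y = g y) :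
    T r f x = T r g x :=
  le_antisymm (T_mono fun y hy => (hfg y hy).le) (T_mono fun y hy => (hfg y hy).ge)

lemma T_comp_mul (g f : X → ℝ≥0∞) (x : X) :
    T r (fun y => g (r y) * f y) x = g x * T r f x := by
  have : T r (fun y => g (r y) * f y) x = T r (fun y => g x * f y) x :=
    T_congr fun y hy => by rw [hy]
  rw [this]
  unfold T
  rw [ENNReal.tsum_mul_left]
  ring

lemma T_eq_zero {f : X → ℝ≥0∞} {x : X} : T r f x = 0 ↔ ∀ y, r y = x → f y = 0 := by
  unfold T
  simp

lemma T_iSup (hfin : ∀ x, (r ⁻¹' {x}).Finite) (f : ℕ → X → ℝ≥0∞) (hf : Monotone f) (x : X) :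
    T r (fun y => ⨆ n, f n y) x = ⨆ n, T r (f n) x := by
  have : Fintype (r ⁻¹' {x}) := (hfin x).fintype
  unfold T
  simp only [tsum_fintype]
  rw [ENNReal.finsetSum_iSup_of_monotone (f := fun (y : r ⁻¹' {x}) n => f n y)
    (fun y i j hij => hf hij y), ENNReal.mul_iSup]

lemma ofReal_transfer (hsur : Function.Surjective r) (hfin : ∀ x, (r ⁻¹' {x}).Finite)
    (f : X → ℝ) (hf : ∀ x, 0 ≤ f x) (x : X) :
    ENNReal.ofReal (transfer r f x) = T r (fun y => ENNReal.ofReal (f y)) x := by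
  have : Fintype (r ⁻¹' {x}) := (hfin x).fintype
  have hc := card_ne hsur hfin x
  unfold T transfer
  simp only [tsum_fintype]
  rw [ENNReal.ofReal_mul (by positivity), ENNReal.ofReal_inv_of_pos (by positivity),
    ENNReal.ofReal_natCast, ENNReal.ofReal_sum_of_nonneg (fun (i : r ⁻¹' {x}) _ => hf i)]

lemma transfer_nonneg (f : X → ℝ) (hf : ∀ x, 0 ≤ f x) (x : X) : 0 ≤ transfer r f x := by
  unfold transfer
  have : 0 ≤ ∑' y : r ⁻¹' {x}, f y := tsum_nonneg (fun y => hf y)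
  positivity

lemma transfer_add_one (hsur : Function.Surjective r) (hfin : ∀ x, (r ⁻¹' {x}).Finite)
    (f : X → ℝ) (x : X) : transfer r (fun y => f y + 1) x = transfer r f x + 1 := by
  have : Fintype (r ⁻¹' {x}) := (hfin x).fintype
  have hc := card_ne hsur hfin x
  unfold transfer
  simp only [tsum_fintype, Finset.sum_add_distrib, mul_add]
  congr 1
  rw [Finset.sum_const, Finset.card_univ, ← Nat.card_eq_fintype_card]
  simp only [nsmul_eq_mul, mul_one]
  exact inv_mul_cancel₀ (by exact_mod_cast hc)

lemma transfer_abs_le (hsur : Function.Surjective r) (hfin : ∀ x, (r ⁻¹' {x}).Finite)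
    (f : X → ℝ) (C : ℝ) (hC : ∀ x, |f x| ≤ C) (x : X) : |transfer r f x| ≤ C := by
  have : Fintype (r ⁻¹' {x}) := (hfin x).fintype
  have hc := card_ne hsur hfin x
  have hc' : (0 : ℝ) < Nat.card (r ⁻¹' {x}) := by positivity
  unfold transfer
  simp only [tsum_fintype]
  rw [abs_mul, abs_of_pos (inv_pos.2 hc'), inv_mul_le_iff₀ hc']
  refine (Finset.abs_sum_le_sum_abs _ _).trans ?_
  refine (Finset.sum_le_card_nsmul _ _ C (fun (y : r ⁻¹' {x}) _ => hC y)).trans ?_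
  rw [Finset.card_univ, ← Nat.card_eq_fintype_card, nsmul_eq_mul]

end basic

section meas
variable {X : Type} [MeasurableSpace X] {r : X → X} {μ : Measure X} [IsProbabilityMeasure μ]

lemma aesm_transfer (hsur : Function.Surjective r) (hfin : ∀ x, (r ⁻¹' {x}).Finite)
    (hinv : StronglyInvariant r μ) (f : X → ℝ) (hf : BddMeasurable f) :
    AEStronglyMeasurable (transfer r f) μ := by
  by_contra hcon
  have h1 : ∫ x, f x ∂μ = 0 := by
    rw [hinv f hf]; exact integral_non_aestronglyMeasurable hcon
  obtain ⟨hfm, C, hC⟩ := hf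
  have hb : BddMeasurable (fun y => f y + 1) :=
    ⟨hfm.add_const 1, C + 1, fun x => (abs_add_le _ _).trans (by simpa using hC x)⟩
  have h2 : ∫ x, (f x + 1) ∂μ = 0 := by
    rw [hinv _ hb]
    apply integral_non_aestronglyMeasurable
    intro h
    apply hcon
    have := h.sub (aestronglyMeasurable_const (b := (1 : ℝ)))
    refine this.congr (ae_of_all _ fun x => ?_)
    simp [transfer_add_one hsur hfin]
  have hi : Integrable f μ := Integrable.of_bound hfm.aestronglyMeasurable C (ae_of_all _ hC)
  rw [integral_add hi (integrable_const _), h1] at h2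
  simp at h2

lemma T_bdd (hsur : Function.Surjective r) (hfin : ∀ x, (r ⁻¹' {x}).Finite)
    (hinv : StronglyInvariant r μ) (f : X → ℝ) (hf : BddMeasurable f) (h0 : ∀ x, 0 ≤ f x) :
    AEMeasurable (T r (fun y => ENNReal.ofReal (f y))) μ ∧
    ∫⁻ x, T r (fun y => ENNReal.ofReal (f y)) x ∂μ = ∫⁻ x, ENNReal.ofReal (f x) ∂μ := by
  have hm := aesm_transfer hsur hfin hinv f hf
  have he : T r (fun y => ENNReal.ofReal (f y)) = fun x => ENNReal.ofReal (transfer r f x) :=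
    funext fun x => (ofReal_transfer hsur hfin f h0 x).symm
  rw [he]
  refine ⟨hm.aemeasurable.ennreal_ofReal, ?_⟩
  obtain ⟨C, hC⟩ := hf.2
  rw [← ofReal_integral_eq_lintegral_ofReal, ← ofReal_integral_eq_lintegral_ofReal, hinv f hf]
  · exact Integrable.of_bound hf.1.aestronglyMeasurable C (ae_of_all _ hC)
  · exact ae_of_all _ h0
  · exact Integrable.of_bound hm C (ae_of_all _ (transfer_abs_le hsur hfin f C hC))
  · exact ae_of_all _ (transfer_nonneg f h0)

lemma T_meas (hsur : Function.Surjective r) (hfin : ∀ x, (r ⁻¹' {x}).Finite)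
    (hinv : StronglyInvariant r μ) (f : X → ℝ≥0∞) (hf : Measurable f) :
    AEMeasurable (T r f) μ ∧ ∫⁻ x, T r f x ∂μ = ∫⁻ x, f x ∂μ := by
  have key : ∀ n : ℕ, AEMeasurable (T r (fun y => min (f y) n)) μ ∧
      ∫⁻ x, T r (fun y => min (f y) n) x ∂μ = ∫⁻ x, min (f x) n ∂μ := by
    intro n
    have hne : ∀ y, min (f y) (n : ℝ≥0∞) ≠ ∞ := fun y =>
      ne_top_of_le_ne_top (ENNReal.natCast_ne_top n) (min_le_right _ _)
    have := T_bdd hsur hfin hinv (fun y => (min (f y) (n : ℝ≥0∞)).toReal)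
      ⟨(hf.min measurable_const).ennreal_toReal, n, fun x => by
        rw [abs_of_nonneg ENNReal.toReal_nonneg]
        exact ENNReal.toReal_le_of_le_ofReal (by positivity) (by simp)⟩
      (fun x => ENNReal.toReal_nonneg)
    simpa only [ENNReal.ofReal_toReal (hne _)] using this
  have hmono : Monotone (fun (n : ℕ) y => min (f y) (n : ℝ≥0∞)) := by
    intro i j hij y
    exact min_le_min le_rfl (by exact_mod_cast hij)
  have hsup : ∀ y, f y = ⨆ n : ℕ, min (f y) (n : ℝ≥0∞) := by
    intro y
    rw [← inf_iSup_eq, ENNReal.iSup_natCast, inf_top_eq]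
  have hT : T r f = fun x => ⨆ n : ℕ, T r (fun y => min (f y) n) x := by
    funext x
    rw [← T_iSup hfin _ hmono x]
    exact T_congr fun y _ => hsup y
  have hTm : AEMeasurable (T r f) μ := by
    rw [hT]; exact AEMeasurable.iSup fun n => (key n).1
  refine ⟨hTm, ?_⟩
  calc ∫⁻ x, T r f x ∂μ = ∫⁻ x, ⨆ n : ℕ, T r (fun y => min (f y) n) x ∂μ := by rw [hT]
    _ = ⨆ n : ℕ, ∫⁻ x, T r (fun y => min (f y) n) x ∂μ :=
        lintegral_iSup' (fun n => (key n).1)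
          (ae_of_all _ fun x i j hij => T_mono fun y _ => hmono hij y)
    _ = ⨆ n : ℕ, ∫⁻ x, min (f x) n ∂μ := by simp only [(key _).2]
    _ = ∫⁻ x, ⨆ n : ℕ, min (f x) n ∂μ :=
        (lintegral_iSup (fun n => hf.min measurable_const) hmono).symm
    _ = ∫⁻ x, f x ∂μ := by simp only [← hsup]

lemma ae_fiber (hsur : Function.Surjective r) (hfin : ∀ x, (r ⁻¹' {x}).Finite)
    (hinv : StronglyInvariant r μ) {p : X → Prop} (hp : ∀ᵐ y ∂μ, p y) :
    ∀ᵐ x ∂μ, ∀ y, r y = x → p y := by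
  obtain ⟨N, hN, hNm, hN0⟩ := exists_measurable_superset_of_null (ae_iff.1 hp)
  have h := T_meas hsur hfin hinv (N.indicator 1) (measurable_one.indicator hNm)
  have h0 : ∫⁻ x, T r (N.indicator 1) x ∂μ = 0 := by
    rw [h.2, lintegral_indicator_one hNm, hN0]
  rw [lintegral_eq_zero_iff' h.1] at h0
  filter_upwards [h0] with x hx y hy
  have := T_eq_zero.1 hx y hy
  by_contra hpy
  have hyN : y ∈ N := hN hpy
  simp [hyN] at this

lemma T_ae_congr (hsur : Function.Surjective r) (hfin : ∀ x, (r ⁻¹' {x}).Finite)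
    (hinv : StronglyInvariant r μ) {f g : X → ℝ≥0∞} (hfg : f =ᵐ[μ] g) : T r f =ᵐ[μ] T r g := by
  filter_upwards [ae_fiber hsur hfin hinv hfg] with x hx
  exact T_congr hx

lemma T_aemeas (hsur : Function.Surjective r) (hfin : ∀ x, (r ⁻¹' {x}).Finite)
    (hinv : StronglyInvariant r μ) (f : X → ℝ≥0∞) (hf : AEMeasurable f μ) :
    AEMeasurable (T r f) μ ∧ ∫⁻ x, T r f x ∂μ = ∫⁻ x, f x ∂μ := by
  have h := T_meas hsur hfin hinv _ hf.measurable_mk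
  have hc := T_ae_congr hsur hfin hinv hf.ae_eq_mk
  exact ⟨h.1.congr hc.symm, by rw [lintegral_congr_ae hc, h.2, ← lintegral_congr_ae hf.ae_eq_mk]⟩

end meas

section ruelle
variable {X : Type} {r : X → X}

/-- Ruelle operator on `ℝ≥0∞`-valued functions. -/
noncomputable def R (r : X → X) (W : X → ℝ≥0∞) (f : X → ℝ≥0∞) : X → ℝ≥0∞ :=
  T r (fun y => W y * f y)

/-- Cocycle products of the weight. -/
noncomputable def Wn (r : X → X) (W : X → ℝ≥0∞) : ℕ → X → ℝ≥0∞
  | 0, _ => 1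
  | n + 1, x => W x * Wn r W n (r x)

lemma Wn_succ' (W : X → ℝ≥0∞) (n : ℕ) (x : X) :
    Wn r W (n + 1) x = Wn r W n x * W (r^[n] x) := by
  induction n generalizing x with
  | zero => simp [Wn]
  | succ n ih =>
    rw [Wn, ih (r x), Wn, Function.iterate_succ_apply, mul_assoc]

lemma R_iter_mono (W : X → ℝ≥0∞) (n : ℕ) {f g : X → ℝ≥0∞} (hfg : ∀ x, f x ≤ g x) (x : X) :
    (R r W)^[n] f x ≤ (R r W)^[n] g x := by
  induction n generalizing x with
  | zero => exact hfg x
  | succ n ih =>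
    rw [Function.iterate_succ_apply', Function.iterate_succ_apply']
    exact T_mono fun y _ => mul_le_mul_right (ih y) _

lemma R_iter_zero (W : X → ℝ≥0∞) (n : ℕ) {f : X → ℝ≥0∞} {x : X}
    (hf : ∀ y, r^[n] y = x → f y = 0) : (R r W)^[n] f x = 0 := by
  induction n generalizing x with
  | zero => exact hf x rfl
  | succ n ih =>
    rw [Function.iterate_succ_apply']
    refine T_eq_zero.2 fun y hy => ?_
    rw [ih, mul_zero]
    intro z hz
    exact hf z (by rw [Function.iterate_succ_apply', hz, hy])

lemma ofReal_ruelle_iter (hsur : Function.Surjective r) (hfin : ∀ x, (r ⁻¹' {x}).Finite)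
    (w : X → ℝ) (hw : ∀ x, 0 ≤ w x) (n : ℕ) (f : X → ℝ) (hf : ∀ x, 0 ≤ f x) :
    (∀ x, 0 ≤ (ruelle r w)^[n] f x) ∧ ∀ x, ENNReal.ofReal ((ruelle r w)^[n] f x) =
      (R r (fun y => ENNReal.ofReal (w y)))^[n] (fun y => ENNReal.ofReal (f y)) x := by
  induction n with
  | zero => exact ⟨hf, fun x => rfl⟩
  | succ n ih =>
    have hnn : ∀ x, 0 ≤ w x * (ruelle r w)^[n] f x := fun x => mul_nonneg (hw x) (ih.1 x)
    simp only [Function.iterate_succ_apply']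
    refine ⟨fun x => transfer_nonneg _ hnn x, fun x => ?_⟩
    refine (ofReal_transfer hsur hfin _ hnn x).trans (T_congr fun y _ => ?_)
    rw [ENNReal.ofReal_mul (hw y), ih.2 y]

variable [MeasurableSpace X] {μ : Measure X} [IsProbabilityMeasure μ]

lemma Wn_meas (hr : Measurable r) {W : X → ℝ≥0∞} (hW : Measurable W) (n : ℕ) :
    Measurable (Wn r W n) := by
  induction n with
  | zero => exact measurable_const
  | succ n ih => exact hW.mul (ih.comp hr)

lemma R_iter_congr (hsur : Function.Surjective r) (hfin : ∀ x, (r ⁻¹' {x}).Finite)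
    (hinv : StronglyInvariant r μ) (W : X → ℝ≥0∞) (n : ℕ) {f g : X → ℝ≥0∞} (hfg : f =ᵐ[μ] g) :
    (R r W)^[n] f =ᵐ[μ] (R r W)^[n] g := by
  induction n with
  | zero => exact hfg
  | succ n ih =>
    rw [Function.iterate_succ_apply', Function.iterate_succ_apply']
    apply T_ae_congr hsur hfin hinv
    filter_upwards [ih] with x hx
    rw [hx]

lemma R_iter_fix (hsur : Function.Surjective r) (hfin : ∀ x, (r ⁻¹' {x}).Finite)
    (hinv : StronglyInvariant r μ) (W : X → ℝ≥0∞) (n : ℕ) {f : X → ℝ≥0∞}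
    (hf : R r W f =ᵐ[μ] f) : (R r W)^[n] f =ᵐ[μ] f := by
  induction n with
  | zero => exact ae_eq_refl _
  | succ n ih =>
    rw [Function.iterate_succ_apply]
    exact (R_iter_congr hsur hfin hinv W n hf).trans ih

lemma R_iter_aemeas (hsur : Function.Surjective r) (hfin : ∀ x, (r ⁻¹' {x}).Finite)
    (hinv : StronglyInvariant r μ) {W : X → ℝ≥0∞} (hW : Measurable W) (n : ℕ) {f : X → ℝ≥0∞}
    (hf : AEMeasurable f μ) : AEMeasurable ((R r W)^[n] f) μ := by
  induction n with
  | zero => exact hf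
  | succ n ih =>
    rw [Function.iterate_succ_apply']
    exact (T_aemeas hsur hfin hinv _ (hW.aemeasurable.mul ih)).1

lemma lintegral_R_iter (hr : Measurable r)
    (hsur : Function.Surjective r) (hfin : ∀ x, (r ⁻¹' {x}).Finite)
    (hinv : StronglyInvariant r μ) {W : X → ℝ≥0∞} (hW : Measurable W) (n : ℕ) {f : X → ℝ≥0∞}
    (hf : AEMeasurable f μ) :
    ∫⁻ x, (R r W)^[n] f x ∂μ = ∫⁻ x, Wn r W n x * f x ∂μ := by
  induction n generalizing f with
  | zero => simp [Wn]
  | succ n ih =>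
    rw [Function.iterate_succ_apply]
    have hRf : AEMeasurable (R r W f) μ :=
      (T_aemeas hsur hfin hinv _ (hW.aemeasurable.mul hf)).1
    rw [ih hRf]
    have : ∀ x, Wn r W n x * R r W f x = T r (fun y => Wn r W n (r y) * (W y * f y)) x :=
      fun x => (T_comp_mul _ _ x).symm
    simp only [this]
    rw [(T_aemeas hsur hfin hinv (fun y => Wn r W n (r y) * (W y * f y)) (((Wn_meas hr hW n).comp hr).aemeasurable.mul
      (hW.aemeasurable.mul hf))).2]
    refine lintegral_congr fun x => ?_
    rw [Wn]; ring

end ruelle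

section omega
variable {X : Type} [MeasurableSpace X] {r : X → X} {μ : Measure X} [IsProbabilityMeasure μ]

/-- The marginal measures. -/
noncomputable def om (r : X → X) (μ : Measure X) (W H : X → ℝ≥0∞) (n : ℕ) : Measure X :=
  μ.withDensity (fun x => Wn r W n x * H x)

lemma om_eq (hr : Measurable r) (hsur : Function.Surjective r) (hfin : ∀ x, (r ⁻¹' {x}).Finite)
    (hinv : StronglyInvariant r μ) {W H : X → ℝ≥0∞} (hW : Measurable W) (hH : Measurable H)
    (n : ℕ) {E : Set X} (hE : MeasurableSet E) :
    om r μ W H n E = ∫⁻ x, (R r W)^[n] (E.indicator H) x ∂μ := by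
  rw [lintegral_R_iter hr hsur hfin hinv hW n (hH.indicator hE).aemeasurable, om,
    withDensity_apply _ hE, ← lintegral_indicator hE]
  refine lintegral_congr fun x => ?_
  by_cases hx : x ∈ E <;> simp [hx]

lemma om_succ (hr : Measurable r) (hsur : Function.Surjective r)
    (hfin : ∀ x, (r ⁻¹' {x}).Finite)
    (hinv : StronglyInvariant r μ) {W H : X → ℝ≥0∞} (hW : Measurable W) (hH : Measurable H)
    (hfix : R r W H =ᵐ[μ] H) (n : ℕ) {E : Set X} (hE : MeasurableSet E) :
    om r μ W H (n + 1) (r ⁻¹' E) = om r μ W H n E := by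
  rw [om_eq hr hsur hfin hinv hW hH _ hE, om_eq hr hsur hfin hinv hW hH _ (hr hE)]
  rw [Function.iterate_succ_apply]
  refine lintegral_congr_ae (R_iter_congr hsur hfin hinv W n ?_)
  filter_upwards [hfix] with x hx
  have : R r W ((r ⁻¹' E).indicator H) x
      = T r (fun y => (E.indicator 1 : X → ℝ≥0∞) (r y) * (W y * H y)) x := by
    refine T_congr fun y _ => ?_
    by_cases hy : r y ∈ E
    · have : y ∈ r ⁻¹' E := hy
      simp [hy]
    · have : y ∉ r ⁻¹' E := hy
      simp [hy]
  rw [this, T_comp_mul]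
  change _ * R r W H x = _
  rw [hx]
  by_cases hy : x ∈ E <;> simp [hy]

lemma om_iter (hr : Measurable r) (hsur : Function.Surjective r)
    (hfin : ∀ x, (r ⁻¹' {x}).Finite)
    (hinv : StronglyInvariant r μ) {W H : X → ℝ≥0∞} (hW : Measurable W) (hH : Measurable H)
    (hfix : R r W H =ᵐ[μ] H) (n k : ℕ) {E : Set X} (hE : MeasurableSet E) :
    om r μ W H (n + k) (r^[k] ⁻¹' E) = om r μ W H n E := by
  induction k with
  | zero => rfl
  | succ k ih =>
    rw [← ih, ← om_succ hr hsur hfin hinv hW hH hfix (n + k) (hr.iterate k hE)]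
    rfl

lemma om_le (hr : Measurable r) (hsur : Function.Surjective r)
    (hfin : ∀ x, (r ⁻¹' {x}).Finite)
    (hinv : StronglyInvariant r μ) {W H : X → ℝ≥0∞} (hW : Measurable W) (hH : Measurable H)
    (hfix : R r W H =ᵐ[μ] H) (n : ℕ) (E : Set X) :
    om r μ W H n E ≤ ∫⁻ x, H x ∂μ := by
  refine (measure_mono (Set.subset_univ E)).trans ?_
  rw [om_eq hr hsur hfin hinv hW hH _ MeasurableSet.univ, Set.indicator_univ]
  exact (lintegral_congr_ae (R_iter_fix hsur hfin hinv W n hfix)).le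

end omega

section space
variable {X : Type} {r : X → X}

lemma theta_iter (n k : ℕ) (z : Xinf r) : r^[k] (theta r (n + k) z) = theta r n z := by
  induction k with
  | zero => rfl
  | succ k ih => rw [← ih, Function.iterate_succ_apply]; exact congrArg _ (z.2 (n + k))

lemma theta_surj (hsur : Function.Surjective r) (n : ℕ) : Function.Surjective (theta r n) := by
  intro x
  obtain ⟨s, hs⟩ := hsur.hasRightInverse
  refine ⟨⟨fun k => if k ≤ n then r^[n - k] x else s^[k - n] x, fun k => ?_⟩, ?_⟩
  · by_cases h1 : k + 1 ≤ n
    · have h2 : k ≤ n := by omega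
      simp only [h1, h2, if_true]
      have : n - k = (n - (k + 1)) + 1 := by omega
      rw [this, Function.iterate_succ_apply']
    · simp only [h1, if_false]
      have : k + 1 - n = (k - n) + 1 := by omega
      rw [this, Function.iterate_succ_apply', hs]
      by_cases h2 : k ≤ n
      · have : k = n := by omega
        subst this; simp
      · simp [h2]
  · simp [theta]

/-- Cylinder sets. -/
def Cyl [MeasurableSpace X] (r : X → X) : Set (Set (Xinf r)) :=
  {A | ∃ (n : ℕ) (E : Set X), MeasurableSet E ∧ A = theta r n ⁻¹' E}

lemma preim_lift (n k : ℕ) (E : Set X) :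
    theta r n ⁻¹' E = theta r (n + k) ⁻¹' (r^[k] ⁻¹' E) := by
  ext z; simp [theta_iter]

variable [MeasurableSpace X]

lemma cyl_pair (hr : Measurable r) {A B : Set (Xinf r)} (hA : A ∈ Cyl r) (hB : B ∈ Cyl r) :
    ∃ (n : ℕ) (E F : Set X), MeasurableSet E ∧ MeasurableSet F ∧ A = theta r n ⁻¹' E ∧
      B = theta r n ⁻¹' F := by
  obtain ⟨n, E, hE, rfl⟩ := hA
  obtain ⟨k, F, hF, rfl⟩ := hB
  refine ⟨n + k, r^[k] ⁻¹' E, r^[n] ⁻¹' F, hr.iterate k hE, hr.iterate n hF,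
    preim_lift n k E, ?_⟩
  rw [add_comm]; exact preim_lift k n F

lemma cyl_ring (hr : Measurable r) : IsSetRing (Cyl r) where
  empty_mem := ⟨0, ∅, MeasurableSet.empty, rfl⟩
  union_mem := by
    intro s t hs ht
    obtain ⟨n, E, F, hE, hF, rfl, rfl⟩ := cyl_pair hr hs ht
    exact ⟨n, E ∪ F, hE.union hF, rfl⟩
  sdiff_mem := by
    intro s t hs ht
    obtain ⟨n, E, F, hE, hF, rfl, rfl⟩ := cyl_pair hr hs ht
    exact ⟨n, E \ F, hE.diff hF, rfl⟩

lemma theta_meas (n : ℕ) : Measurable (theta r n) :=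
  (measurable_pi_apply n).comp measurable_subtype_coe

lemma cyl_gen : (inferInstance : MeasurableSpace (Xinf r)) = MeasurableSpace.generateFrom (Cyl r) := by
  apply le_antisymm
  · have : Measurable[MeasurableSpace.generateFrom (Cyl r), MeasurableSpace.pi]
        (Subtype.val : Xinf r → ℕ → X) := by
      rw [@measurable_pi_iff]
      intro n E hE
      exact MeasurableSpace.measurableSet_generateFrom ⟨n, E, hE, rfl⟩
    exact this.comap_le
  · apply MeasurableSpace.generateFrom_le
    rintro _ ⟨n, E, hE, rfl⟩
    exact theta_meas n hE

/-- Koenig's lemma for nested cylinder sets. -/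
lemma koenig (hfin : ∀ x, (r ⁻¹' {x}).Finite) (s : ℕ → Set (Xinf r)) (hs : ∀ k, s k ∈ Cyl r)
    (hanti : Antitone s) (hemp : ⋂ k, s k = ∅) (x : X) :
    ∃ k, ∀ z ∈ s k, theta r 0 z ≠ x := by
  by_contra! hcon
  let _ : TopologicalSpace X := ⊥
  have : DiscreteTopology X := ⟨rfl⟩
  have hfinn : ∀ n : ℕ, (r^[n] ⁻¹' {x}).Finite := by
    intro n
    induction n with
    | zero => simp
    | succ n ih =>
      have : r^[n + 1] ⁻¹' {x} = ⋃ y ∈ r^[n] ⁻¹' {x}, r ⁻¹' {y} := by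
        ext z; simp
      rw [this]
      exact ih.biUnion fun y _ => hfin y
  have hK : IsCompact (Set.pi Set.univ (fun n : ℕ => r^[n] ⁻¹' {x})) :=
    isCompact_univ_pi fun n => (hfinn n).isCompact
  have hcont : ∀ n, Continuous (fun z : ℕ → X => z n) := fun n => continuous_apply n
  have hX : IsClosed (Xinf r) := by
    have : Xinf r = ⋂ n, {z : ℕ → X | r (z (n + 1)) = z n} := by
      ext z; simp [Xinf]
    rw [this]
    refine isClosed_iInter fun n => isClosed_eq ?_ (hcont n)
    exact continuous_of_discreteTopology.comp (hcont (n + 1))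
  have hcl : ∀ k, IsClosed ((Subtype.val '' (s k)) : Set (ℕ → X)) := by
    intro k
    obtain ⟨n, E, -, hE⟩ := hs k
    have : (Subtype.val '' (s k) : Set (ℕ → X)) = Xinf r ∩ (fun z => z n) ⁻¹' E := by
      rw [hE]; ext z
      constructor
      · rintro ⟨w, hw, rfl⟩; exact ⟨w.2, hw⟩
      · rintro ⟨h1, h2⟩; exact ⟨⟨z, h1⟩, h2, rfl⟩
    rw [this]
    exact hX.inter ((isClosed_discrete E).preimage (hcont n))
  have hne := IsCompact.nonempty_iInter_of_sequence_nonempty_isCompact_isClosed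
    (fun k => Set.pi Set.univ (fun n : ℕ => r^[n] ⁻¹' {x}) ∩ Subtype.val '' (s k))
    (fun k => Set.inter_subset_inter_right _ (Set.image_mono (hanti (Nat.le_succ k))))
    (fun k => by
      obtain ⟨z, hz, hzx⟩ := hcon k
      refine ⟨z.1, fun n _ => ?_, z, hz, rfl⟩
      have := theta_iter 0 n z
      rw [zero_add, hzx] at this
      exact this)
    (hK.inter_right (hcl 0)) (fun k => hK.isClosed.inter (hcl k))
  obtain ⟨z, hz⟩ := hne
  rw [Set.mem_iInter] at hz
  obtain ⟨-, w, hw, rfl⟩ := hz 0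
  have : w ∈ ⋂ k, s k := by
    rw [Set.mem_iInter]
    intro k
    obtain ⟨-, w', hw', he⟩ := hz k
    rwa [← Subtype.ext he]
  rw [hemp] at this
  exact this

end space

section main
variable {X : Type} [MeasurableSpace X] {r : X → X} {μ : Measure X} [IsProbabilityMeasure μ]

open Classical in
/-- The content on cylinder sets. -/
noncomputable def cont (r : X → X) (μ : Measure X) (W H : X → ℝ≥0∞) (A : Set (Xinf r)) : ℝ≥0∞ :=
  if hA : A ∈ Cyl r then om r μ W H hA.choose hA.choose_spec.choose else 0

lemma cont_eq (hr : Measurable r) (hsur : Function.Surjective r)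
    (hfin : ∀ x, (r ⁻¹' {x}).Finite)
    (hinv : StronglyInvariant r μ) {W H : X → ℝ≥0∞} (hW : Measurable W) (hH : Measurable H)
    (hfix : R r W H =ᵐ[μ] H) (n : ℕ) {E : Set X} (hE : MeasurableSet E) :
    cont r μ W H (theta r n ⁻¹' E) = om r μ W H n E := by
  have hA : theta r n ⁻¹' E ∈ Cyl r := ⟨n, E, hE, rfl⟩
  rw [cont, dif_pos hA]
  obtain ⟨hF, heq⟩ := hA.choose_spec.choose_spec
  generalize hA.choose_spec.choose = F at *
  generalize hA.choose = k at *
  rw [← om_iter hr hsur hfin hinv hW hH hfix n k hE,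
    ← om_iter hr hsur hfin hinv hW hH hfix k n hF, add_comm k n]
  congr 1
  rw [preim_lift n k E, preim_lift k n F, add_comm k n] at heq
  exact ((theta_surj hsur (n + k)).preimage_injective heq).symm

lemma main (hr : Measurable r) (hsur : Function.Surjective r)
    (hfin : ∀ x, (r ⁻¹' {x}).Finite)
    (hinv : StronglyInvariant r μ) {W H : X → ℝ≥0∞} (hW : Measurable W) (hH : Measurable H)
    (hfix : R r W H =ᵐ[μ] H) (hHfin : ∫⁻ x, H x ∂μ ≠ ∞) :
    ∃ μhat : Measure (Xinf r),
      (∀ (n : ℕ) (E : Set X), MeasurableSet E → μhat (theta r n ⁻¹' E) = om r μ W H n E) ∧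
      (∀ ν : Measure (Xinf r),
        (∀ (n : ℕ) (E : Set X), MeasurableSet E → ν (theta r n ⁻¹' E) = om r μ W H n E) →
        ν = μhat) ∧
      μhat.map (rhatInv r) = μhat.withDensity fun xh => W (theta r 0 xh) := by
  have hc := fun n {E : Set X} (hE : MeasurableSet E) =>
    cont_eq hr hsur hfin hinv hW hH hfix n hE
  let m : AddContent ℝ≥0∞ (Cyl r) := (cyl_ring hr).addContent_of_union (cont r μ W H)
    (by
      have := hc 0 MeasurableSet.empty
      simpa using this)
    (by
      intro s t hs ht hd
      obtain ⟨n, E, F, hE, hF, rfl, rfl⟩ := cyl_pair hr hs ht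
      rw [← Set.preimage_union, hc n hE, hc n hF, hc n (hE.union hF)]
      exact measure_union ((Set.disjoint_preimage_iff (theta_surj hsur n)).1 hd) hF)
  have hm : ∀ n {E : Set X}, MeasurableSet E → m (theta r n ⁻¹' E) = om r μ W H n E :=
    fun n E hE => hc n hE
  have hle := om_le hr hsur hfin hinv hW hH hfix
  have hsub : m.IsSigmaSubadditive := by
    apply isSigmaSubadditive_of_addContent_iUnion_eq_tsum (cyl_ring hr)
    intro f hf hU hd
    refine addContent_iUnion_eq_sum_of_tendsto_zero (cyl_ring hr) m ?_ ?_ hf hU hd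
    · rintro _ ⟨n, E, hE, rfl⟩
      rw [hm n hE]
      exact ne_top_of_le_ne_top hHfin (hle n E)
    · intro s hs hanti hemp
      have hkey := koenig hfin s hs hanti hemp
      choose n E hE hsE using hs
      have hms : ∀ k, m (s k) = ∫⁻ x, (R r W)^[n k] ((E k).indicator H) x ∂μ := by
        intro k
        rw [hsE k, hm _ (hE k), om_eq hr hsur hfin hinv hW hH _ (hE k)]
      simp only [hms]
      have := tendsto_lintegral_of_dominated_convergence' (μ := μ) (f := fun _ => 0)
        (F := fun k x => (R r W)^[n k] ((E k).indicator H) x) H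
        (fun k => R_iter_aemeas hsur hfin hinv hW _ (hH.indicator (hE k)).aemeasurable)
        (fun k => by
          filter_upwards [R_iter_fix hsur hfin hinv W (n k) hfix] with x hx
          rw [← hx]
          exact R_iter_mono W (n k) (fun y => Set.indicator_le_self _ _ y) x)
        hHfin
        (ae_of_all _ fun x => by
          obtain ⟨k, hk⟩ := hkey x
          refine tendsto_const_nhds.congr' ?_
          filter_upwards [eventually_ge_atTop k] with j hj
          refine (R_iter_zero W (n j) fun y hy => ?_).symm
          refine Set.indicator_of_notMem (fun hyE => ?_) _
          obtain ⟨z, rfl⟩ := theta_surj hsur (n j) y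
          have hz : z ∈ s j := by rw [hsE j]; exact hyE
          refine hk z (hanti hj hz) ?_
          rw [← hy]
          have := theta_iter 0 (n j) z
          rw [zero_add] at this
          exact this.symm)
      simpa using this
  have hgen := cyl_gen (r := r)
  let μhat : Measure (Xinf r) := m.measure (cyl_ring hr).isSetSemiring hgen.le hsub
  have h1 : ∀ (n : ℕ) (E : Set X), MeasurableSet E →
      μhat (theta r n ⁻¹' E) = om r μ W H n E := by
    intro n E hE
    rw [← hm n hE]
    exact m.measure_eq (cyl_ring hr).isSetSemiring hgen hsub ⟨n, E, hE, rfl⟩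
  have hpi : IsPiSystem (Cyl r) := (cyl_ring hr).isSetSemiring.isPiSystem
  have huniq : ∀ ν ν' : Measure (Xinf r), ν Set.univ ≠ ∞ →
      (∀ (n : ℕ) (E : Set X), MeasurableSet E →
        ν (theta r n ⁻¹' E) = ν' (theta r n ⁻¹' E)) → ν = ν' := by
    intro ν ν' hν he
    have : IsFiniteMeasure ν := ⟨hν.lt_top⟩
    refine ext_of_generate_finite (Cyl r) hgen hpi ?_ (he 0 Set.univ MeasurableSet.univ)
    rintro _ ⟨n, E, hE, rfl⟩
    exact he n E hE
  refine ⟨μhat, h1, ?_, ?_⟩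
  · intro ν hν
    refine huniq ν μhat ?_ fun n E hE => by rw [hν n E hE, h1 n E hE]
    have := hν 0 Set.univ MeasurableSet.univ
    rw [Set.preimage_univ] at this
    rw [this]
    exact ne_top_of_le_ne_top hHfin (hle 0 _)
  · have hri : Measurable (rhatInv r) := by
      apply Measurable.subtype_mk
      exact measurable_pi_iff.2 fun n => theta_meas (n + 1)
    have hmap : ∀ (n : ℕ) (E : Set X), MeasurableSet E →
        μhat.map (rhatInv r) (theta r n ⁻¹' E) = om r μ W H (n + 1) E := by
      intro n E hE
      rw [Measure.map_apply hri (theta_meas n hE), ← h1 (n + 1) E hE]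
      rfl
    have hmt : ∀ n, μhat.map (theta r n) = om r μ W H n := by
      intro n
      ext E hE
      rw [Measure.map_apply (theta_meas n) hE, h1 n E hE]
    refine huniq _ _ ?_ fun n E hE => ?_
    · have := hmap 0 Set.univ MeasurableSet.univ
      rw [Set.preimage_univ] at this
      rw [this]
      exact ne_top_of_le_ne_top hHfin (hle 1 _)
    · rw [hmap n E hE, withDensity_apply _ (theta_meas n hE)]
      have hWr : Measurable (fun x => W (r^[n] x)) := hW.comp (hr.iterate n)
      calc om r μ W H (n + 1) E
          = ∫⁻ x in E, Wn r W (n + 1) x * H x ∂μ := by rw [om, withDensity_apply _ hE]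
        _ = ∫⁻ x in E, ((fun x => Wn r W n x * H x) * fun x => W (r^[n] x)) x ∂μ := by
            refine lintegral_congr fun x => ?_
            rw [Wn_succ', Pi.mul_apply]; ring
        _ = ∫⁻ x in E, W (r^[n] x) ∂(om r μ W H n) := by
            have hd : Measurable (fun x => Wn r W n x * H x) := (Wn_meas hr hW n).mul hH
            rw [om, setLIntegral_withDensity_eq_setLIntegral_mul _ hd hWr hE]
        _ = ∫⁻ z in theta r n ⁻¹' E, W (r^[n] (theta r n z)) ∂μhat := by
            rw [← hmt n, setLIntegral_map hE hWr (theta_meas n)]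
        _ = ∫⁻ z in theta r n ⁻¹' E, W (theta r 0 z) ∂μhat := by
            refine lintegral_congr fun z => ?_
            have := theta_iter 0 n z
            rw [zero_add] at this
            rw [this]

end main

end ProjLim

/-- Theorem 4.14: if `h ∈ L¹(X,μ)`, `h ≥ 0` and `R h = h` (where `R` is the Ruelle operator
with weight `|m₀|²`), then there is a unique measure `μ̂` on `X_∞(r)` whose push-forward under
`θ_n` is the measure `ω_n : f ↦ ∫ Rⁿ(f h) dμ` for all `n ≥ 0`; moreover `μ̂ ∘ r̂ ≪ μ̂` with
Radon–Nikodym derivative `d(μ̂ ∘ r̂)/dμ̂ = |m₀ ∘ θ₀|²`. -/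
theorem exists_unique_projective_limit_measure
    (X : Type) [MeasurableSpace X] (r : X → X) (hr : Measurable r)
    (hsur : Function.Surjective r) (hfin : ∀ x, (r ⁻¹' {x}).Finite)
    (μ : Measure X) [IsProbabilityMeasure μ] (hinv : StronglyInvariant r μ)
    (m₀ : X → ℂ) (hm₀ : Measurable m₀) (hm₀b : ∃ C, ∀ x, ‖m₀ x‖ ≤ C)
    (h : X → ℝ) (hmeas : Measurable h) (hint : Integrable h μ) (hpos : ∀ x, 0 ≤ h x)
    (hfix : ∀ᵐ x ∂μ, ruelle r (fun y => ‖m₀ y‖ ^ 2) h x = h x) :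
    ∃ μhat : Measure (Xinf r),
      (∀ (n : ℕ) (E : Set X), MeasurableSet E →
        μhat (theta r n ⁻¹' E) =
          ENNReal.ofReal (∫ x, (ruelle r fun y => ‖m₀ y‖ ^ 2)^[n] (E.indicator h) x ∂μ)) ∧
      (∀ ν : Measure (Xinf r),
        (∀ (n : ℕ) (E : Set X), MeasurableSet E →
          ν (theta r n ⁻¹' E) =
            ENNReal.ofReal (∫ x, (ruelle r fun y => ‖m₀ y‖ ^ 2)^[n] (E.indicator h) x ∂μ)) →
        ν = μhat) ∧
      μhat.map (rhatInv r) =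
        μhat.withDensity fun xh => ENNReal.ofReal (‖m₀ (theta r 0 xh)‖ ^ 2) := by
  classical
  have hW : Measurable (fun y => ENNReal.ofReal (‖m₀ y‖ ^ 2)) :=
    (hm₀.norm.pow_const 2).ennreal_ofReal
  have hH : Measurable (fun y => ENNReal.ofReal (h y)) := hmeas.ennreal_ofReal
  have hw : ∀ y, 0 ≤ ‖m₀ y‖ ^ 2 := fun y => by positivity
  have hfin' : ∫⁻ x, ENNReal.ofReal (h x) ∂μ ≠ ∞ := by
    rw [← ofReal_integral_eq_lintegral_ofReal hint (ae_of_all _ hpos)]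
    exact ENNReal.ofReal_ne_top
  have hfix' : ProjLim.R r (fun y => ENNReal.ofReal (‖m₀ y‖ ^ 2)) (fun y => ENNReal.ofReal (h y))
      =ᵐ[μ] fun y => ENNReal.ofReal (h y) := by
    filter_upwards [hfix] with x hx
    have := (ProjLim.ofReal_ruelle_iter hsur hfin _ hw 1 h hpos).2 x
    simp only [Function.iterate_one] at this
    rw [← this, hx]
  have hval : ∀ (n : ℕ) (E : Set X), MeasurableSet E →
      ENNReal.ofReal (∫ x, (ruelle r fun y => ‖m₀ y‖ ^ 2)^[n] (E.indicator h) x ∂μ) =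
      ProjLim.om r μ (fun y => ENNReal.ofReal (‖m₀ y‖ ^ 2)) (fun y => ENNReal.ofReal (h y)) n E := by
    intro n E hE
    have h0 : ∀ x, 0 ≤ E.indicator h x := Set.indicator_nonneg fun x _ => hpos x
    obtain ⟨hn, he⟩ := ProjLim.ofReal_ruelle_iter hsur hfin _ hw n _ h0
    have hind : (fun y => ENNReal.ofReal (E.indicator h y))
        = E.indicator (fun y => ENNReal.ofReal (h y)) := by
      funext y
      by_cases hy : y ∈ E <;> simp [hy]
    rw [hind] at he
    have hle := ProjLim.om_le hr hsur hfin hinv hW hH hfix' n E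
    rw [ProjLim.om_eq hr hsur hfin hinv hW hH n hE] at hle ⊢
    have hae := ProjLim.R_iter_aemeas hsur hfin hinv hW n (hH.indicator hE).aemeasurable (μ := μ)
    have hmm : AEMeasurable ((ruelle r fun y => ‖m₀ y‖ ^ 2)^[n] (E.indicator h)) μ := by
      refine hae.ennreal_toReal.congr (ae_of_all _ fun x => ?_)
      simp only [← he x]
      exact ENNReal.toReal_ofReal (hn x)
    rw [integral_eq_lintegral_of_nonneg_ae (ae_of_all _ hn) hmm.aestronglyMeasurable]
    simp only [he]
    exact ENNReal.ofReal_toReal (ne_top_of_le_ne_top hfin' hle)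
  obtain ⟨μhat, h1, h2, h3⟩ := ProjLim.main hr hsur hfin hinv hW hH hfix' hfin'
  refine ⟨μhat, fun n E hE => by rw [hval n E hE, h1 n E hE], fun ν hν => h2 ν fun n E hE => ?_, h3⟩
  rw [← hval n E hE, hν n E hE]
end

section
/- Let (m₀, h) be a Perron–Ruelle–Frobenius pair with m₀ non-singular, and let (L²(X_∞(r), μ̂), U, π, φ) be the associated covariant system, where U f = (m₀∘θ₀)·(f∘r̂) and π(g) f = (g∘θ₀)·f. Then a bounded operator A on L²(X_∞(r), μ̂) commutes with U and with π(g) for all g ∈ L^∞(X) if and only if A = M_f, multiplication by a cocycle f, i.e., by a bounded measurable function f : X_∞(r) → ℂ with f = f∘r̂ μ̂-a.e.; conversely, every such cocycle defines an operator in this commutant. -/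
open MeasureTheory
open scoped ENNReal InnerProductSpace

/-- The induced automorphism `r̂(x₀,x₁,…) = (r x₀, x₀, x₁, …)`. -/
def rhat {X : Type} (r : X → X) (xh : Xinf r) : Xinf r :=
  ⟨fun n => Nat.rec (r ((xh : ℕ → X) 0)) (fun k _ => (xh : ℕ → X) k) n, by
    intro n
    cases n with
    | zero => rfl
    | succ k => exact xh.2 k⟩

section Helpers

variable {X : Type}

/-- ENNReal-valued averaging operator. -/
noncomputable def eT (r : X → X) (f : X → ℝ≥0∞) (x : X) : ℝ≥0∞ :=
  (Nat.card (r ⁻¹' {x}) : ℝ≥0∞)⁻¹ * ∑' y : r ⁻¹' {x}, f y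

lemma transfer_add_one (r : X → X) (hsur : Function.Surjective r)
    (hfin : ∀ x, (r ⁻¹' {x}).Finite) (f : X → ℝ) (x : X) :
    transfer r (fun y => f y + 1) x = transfer r f x + 1 := by
  have : Fintype (r ⁻¹' {x}) := (hfin x).fintype
  have hne : Nonempty (r ⁻¹' {x}) := by
    obtain ⟨y, hy⟩ := hsur x
    exact ⟨⟨y, hy⟩⟩
  unfold transfer
  rw [tsum_fintype, tsum_fintype, Finset.sum_add_distrib, mul_add]
  congr 1
  have : (Nat.card (r ⁻¹' {x}) : ℝ) ≠ 0 := by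
    have := Nat.card_pos (α := r ⁻¹' {x})
    positivity
  simp only [Finset.sum_const, Finset.card_univ, nsmul_eq_mul, mul_one]
  rw [← Nat.card_eq_fintype_card]
  exact inv_mul_cancel₀ this

lemma eT_ofReal (r : X → X) (hsur : Function.Surjective r)
    (hfin : ∀ x, (r ⁻¹' {x}).Finite) (f : X → ℝ) (hf : ∀ x, 0 ≤ f x) (x : X) :
    eT r (fun y => ENNReal.ofReal (f y)) x = ENNReal.ofReal (transfer r f x) := by
  have : Fintype (r ⁻¹' {x}) := (hfin x).fintype
  have hne : Nonempty (r ⁻¹' {x}) := by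
    obtain ⟨y, hy⟩ := hsur x
    exact ⟨⟨y, hy⟩⟩
  have hc : (0 : ℝ) < Nat.card (r ⁻¹' {x}) := by
    exact_mod_cast Nat.card_pos (α := r ⁻¹' {x})
  unfold transfer eT
  rw [tsum_fintype, tsum_fintype, ENNReal.ofReal_mul (by positivity),
    ENNReal.ofReal_sum_of_nonneg (f := fun i : r ⁻¹' {x} => f i) (fun i _ => hf i), ENNReal.ofReal_inv_of_pos hc,
    ENNReal.ofReal_natCast]

lemma transfer_nonneg (r : X → X) (f : X → ℝ) (hf : ∀ x, 0 ≤ f x) (x : X) :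
    0 ≤ transfer r f x :=
  mul_nonneg (by positivity) (tsum_nonneg fun y => hf y)

lemma transfer_ind_aesm [MeasurableSpace X] (r : X → X) (hsur : Function.Surjective r)
    (hfin : ∀ x, (r ⁻¹' {x}).Finite) (μ : Measure X) [IsProbabilityMeasure μ]
    (hinv : StronglyInvariant r μ) (E : Set X) (hE : MeasurableSet E) :
    Integrable (transfer r (E.indicator 1)) μ := by
  by_contra hcon
  have hm : Measurable (E.indicator (1 : X → ℝ)) := measurable_one.indicator hE
  have hb : ∀ x, |E.indicator (1 : X → ℝ) x| ≤ 1 := by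
    intro x
    by_cases hx : x ∈ E <;> simp [hx]
  have h1 := hinv (E.indicator 1) ⟨hm, 1, hb⟩
  have h2 := hinv (fun y => E.indicator 1 y + 1) ⟨hm.add_const 1, 2, fun x => by
    refine (abs_add_le _ _).trans ?_
    have := hb x
    simp only [abs_one]; linarith⟩
  rw [integral_undef hcon] at h1
  have hcon2 : ¬ Integrable (fun x => transfer r (fun y => E.indicator 1 y + 1) x) μ := by
    intro hi
    apply hcon
    have := hi.sub (integrable_const (1 : ℝ))
    refine this.congr (Filter.Eventually.of_forall fun x => ?_)
    simp [transfer_add_one r hsur hfin]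
  rw [integral_undef hcon2, integral_add (f := E.indicator (1 : X → ℝ)) ((integrable_const (1 : ℝ)).indicator hE)
    (integrable_const 1)] at h2
  have h1' : ∫ x, E.indicator (1 : X → ℝ) x ∂μ = 0 := h1
  have h3 : ∫ x, E.indicator (fun _ => (1 : ℝ)) x ∂μ = 0 := h1'
  have h4 : ∫ x, E.indicator (1 : X → ℝ) x ∂μ + ∫ x, (1 : ℝ) ∂μ = 0 := h2
  rw [h1'] at h4
  simp at h4

lemma eT_meas [MeasurableSpace X] (r : X → X) (hsur : Function.Surjective r)
    (hfin : ∀ x, (r ⁻¹' {x}).Finite) (μ : Measure X) [IsProbabilityMeasure μ]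
    (hinv : StronglyInvariant r μ) (f : X → ℝ≥0∞) (hf : Measurable f) :
    AEMeasurable (eT r f) μ ∧ ∫⁻ x, eT r f x ∂μ = ∫⁻ x, f x ∂μ := by
  refine Measurable.ennreal_induction (motive := fun f => AEMeasurable (eT r f) μ ∧
    ∫⁻ x, eT r f x ∂μ = ∫⁻ x, f x ∂μ) ?_ ?_ ?_ hf
  · intro c E hE
    have hi := transfer_ind_aesm r hsur hfin μ hinv E hE
    have hn : ∀ x, 0 ≤ E.indicator (1 : X → ℝ) x :=
      fun x => Set.indicator_nonneg (fun _ _ => zero_le_one) x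
    have key : eT r (E.indicator fun _ => c) =
        fun x => c * ENNReal.ofReal (transfer r (E.indicator 1) x) := by
      funext x
      rw [← eT_ofReal r hsur hfin _ hn]
      unfold eT
      rw [mul_left_comm]
      congr 1
      rw [← ENNReal.tsum_mul_left]
      congr 1
      funext y
      by_cases hy : (y : X) ∈ E <;> simp [hy]
    rw [key]
    refine ⟨hi.aemeasurable.ennreal_ofReal.const_mul c, ?_⟩
    rw [lintegral_const_mul'' _ hi.aemeasurable.ennreal_ofReal,
      ← ofReal_integral_eq_lintegral_ofReal hi
        (Filter.Eventually.of_forall (transfer_nonneg r _ hn)),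
      ← hinv _ ⟨measurable_one.indicator hE, 1, fun x => by
        by_cases hx : x ∈ E <;> simp [hx]⟩, lintegral_indicator_const hE,
      integral_indicator_one hE]
    simp
  · intro f g hd hf hg ihf ihg
    have key : eT r (f + g) = fun x => eT r f x + eT r g x := by
      funext x
      unfold eT
      simp only [Pi.add_apply]
      rw [ENNReal.tsum_add, mul_add]
    rw [key]
    refine ⟨ihf.1.add ihg.1, ?_⟩
    rw [lintegral_add_left' ihf.1, ihf.2, ihg.2]
    simp only [Pi.add_apply]
    rw [lintegral_add_left hf]
  · intro f hf hmono ih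
    have key : eT r (fun x => ⨆ n, f n x) = fun x => ⨆ n, eT r (f n) x := by
      funext x
      have : Fintype (r ⁻¹' {x}) := (hfin x).fintype
      unfold eT
      simp only [tsum_fintype]
      rw [ENNReal.finsetSum_iSup_of_monotone (f := fun (y : r ⁻¹' {x}) n => f n y) (fun y => fun a b hab => hmono hab _),
        ENNReal.mul_iSup]
    rw [key]
    refine ⟨AEMeasurable.iSup fun n => (ih n).1, ?_⟩
    rw [lintegral_iSup' (fun n => (ih n).1), lintegral_iSup hf hmono]
    · simp only [(ih _).2]
    · refine Filter.Eventually.of_forall fun x a b hab => ?_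
      unfold eT
      exact mul_le_mul_right (ENNReal.tsum_le_tsum fun y => hmono hab _) _

lemma eT_congr [MeasurableSpace X] (r : X → X) (hsur : Function.Surjective r)
    (hfin : ∀ x, (r ⁻¹' {x}).Finite) (μ : Measure X) [IsProbabilityMeasure μ]
    (hinv : StronglyInvariant r μ) (f g : X → ℝ≥0∞) (hfg : f =ᵐ[μ] g) :
    eT r f =ᵐ[μ] eT r g := by
  obtain ⟨N, hsub, hN, hN0⟩ := exists_measurable_superset_of_null (ae_iff.1 hfg)
  have h1 := eT_meas r hsur hfin μ hinv (N.indicator 1) (measurable_one.indicator hN)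
  have h2 : ∫⁻ x, eT r (N.indicator 1) x ∂μ = 0 := by
    rw [h1.2, lintegral_indicator_one hN, hN0]
  rw [lintegral_eq_zero_iff' h1.1] at h2
  filter_upwards [h2] with x hx
  unfold eT at hx ⊢
  have : Fintype (r ⁻¹' {x}) := (hfin x).fintype
  simp only [Pi.zero_apply, mul_eq_zero, ENNReal.inv_eq_zero, ENNReal.natCast_ne_top, false_or,
    ENNReal.tsum_eq_zero] at hx
  congr 2
  funext y
  by_contra hy
  have : (y : X) ∈ N := hsub hy
  have h3 := hx y
  simp [this] at h3

lemma eT_aemeas [MeasurableSpace X] (r : X → X) (hsur : Function.Surjective r)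
    (hfin : ∀ x, (r ⁻¹' {x}).Finite) (μ : Measure X) [IsProbabilityMeasure μ]
    (hinv : StronglyInvariant r μ) (f : X → ℝ≥0∞) (hf : AEMeasurable f μ) :
    AEMeasurable (eT r f) μ ∧ ∫⁻ x, eT r f x ∂μ = ∫⁻ x, f x ∂μ := by
  have h1 := eT_meas r hsur hfin μ hinv _ hf.measurable_mk
  have h2 := eT_congr r hsur hfin μ hinv _ _ hf.ae_eq_mk
  exact ⟨h1.1.congr h2.symm, by
    rw [lintegral_congr_ae h2, h1.2, ← lintegral_congr_ae hf.ae_eq_mk]⟩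

lemma map_null [MeasurableSpace X] (r : X → X) (hr : Measurable r)
    (hsur : Function.Surjective r)
    (hfin : ∀ x, (r ⁻¹' {x}).Finite) (μ : Measure X) [IsProbabilityMeasure μ]
    (hinv : StronglyInvariant r μ) (W : X → ℝ≥0∞) (hW : Measurable W)
    (f : X → ℝ≥0∞) (hf : AEMeasurable f μ) (n : ℕ) :
    AEMeasurable ((fun u => eT r (fun y => W y * u y))^[n] f) μ ∧
    ∀ g : X → ℝ≥0∞, Measurable g →
      ∫⁻ x, (fun u => eT r (fun y => W y * u y))^[n] f x * g x ∂μ =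
        ∫⁻ x, f x * (∏ i ∈ Finset.range n, W (r^[i] x)) * g (r^[n] x) ∂μ := by
  induction n with
  | zero => simp [hf]
  | succ n ih =>
    simp only [Function.iterate_succ_apply']
    set u := (fun u => eT r (fun y => W y * u y))^[n] f with hu
    refine ⟨(eT_aemeas r hsur hfin μ hinv _ (hW.aemeasurable.mul ih.1)).1, fun g hg => ?_⟩
    have key : ∀ x, eT r (fun y => W y * u y) x * g x =
        eT r (fun y => u y * (W y * g (r y))) x := by
      intro x
      unfold eT
      rw [mul_assoc, ← ENNReal.tsum_mul_right]
      congr 2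
      funext y
      have : r y = x := y.2
      simp only [this]; ring
    simp only [key]
    have hg' : Measurable (fun y => W y * g (r y)) := hW.mul (hg.comp hr)
    rw [(eT_aemeas r hsur hfin μ hinv (fun y => u y * (W y * g (r y)))
      (ih.1.mul hg'.aemeasurable)).2, ih.2 _ hg']
    refine lintegral_congr fun x => ?_
    rw [Finset.prod_range_succ]
    ring

lemma iter_ofReal (r : X → X) (hsur : Function.Surjective r)
    (hfin : ∀ x, (r ⁻¹' {x}).Finite) (W : X → ℝ) (hW : ∀ x, 0 ≤ W x)
    (f : X → ℝ) (hf : ∀ x, 0 ≤ f x) (n : ℕ) :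
    (∀ x, 0 ≤ (ruelle r W)^[n] f x) ∧
    (fun u => eT r (fun y => ENNReal.ofReal (W y) * u y))^[n] (fun x => ENNReal.ofReal (f x)) =
      fun x => ENNReal.ofReal ((ruelle r W)^[n] f x) := by
  induction n with
  | zero => simp [hf]
  | succ n ih =>
    simp only [Function.iterate_succ_apply', ih.2]
    refine ⟨fun x => mul_nonneg (by positivity) (tsum_nonneg fun y => mul_nonneg (hW _) (ih.1 _)),
      ?_⟩
    funext x
    simp only [← ENNReal.ofReal_mul (hW _)]
    exact eT_ofReal r hsur hfin (fun y => W y * (ruelle r W)^[n] f y)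
      (fun y => mul_nonneg (hW _) (ih.1 _)) x

/-- The measure formula. -/
lemma ruelle_formula [MeasurableSpace X] (r : X → X) (hr : Measurable r)
    (hsur : Function.Surjective r)
    (hfin : ∀ x, (r ⁻¹' {x}).Finite) (μ : Measure X) [IsProbabilityMeasure μ]
    (hinv : StronglyInvariant r μ) (W : X → ℝ) (hWm : Measurable W) (hW : ∀ x, 0 ≤ W x)
    (C : ℝ) (hC : ∀ x, W x ≤ C)
    (f : X → ℝ) (hfi : Integrable f μ) (hf : ∀ x, 0 ≤ f x) (n : ℕ) :
    ENNReal.ofReal (∫ x, (ruelle r W)^[n] f x ∂μ) =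
      ∫⁻ x, ENNReal.ofReal (f x) * ∏ i ∈ Finset.range n, ENNReal.ofReal (W (r^[i] x)) ∂μ := by
  obtain ⟨h1, h2⟩ := iter_ofReal r hsur hfin W hW f hf n
  obtain ⟨h3, h4⟩ := map_null r hr hsur hfin μ hinv _ hWm.ennreal_ofReal _
    hfi.aemeasurable.ennreal_ofReal n
  have h5 := h4 1 measurable_one
  rw [h2] at h3 h5
  simp only [Pi.one_apply, mul_one] at h5
  rw [← h5]
  refine ofReal_integral_eq_lintegral_ofReal ?_ (Filter.Eventually.of_forall h1)
  have hm : AEMeasurable (fun x => (ruelle r W)^[n] f x) μ := by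
    refine h3.ennreal_toReal.congr (Filter.Eventually.of_forall fun x => ?_)
    exact ENNReal.toReal_ofReal (h1 x)
  refine ⟨hm.aestronglyMeasurable, ?_⟩
  rw [hasFiniteIntegral_iff_ofReal (Filter.Eventually.of_forall h1), h5]
  calc _ ≤ ∫⁻ x, ENNReal.ofReal (f x) * (ENNReal.ofReal C) ^ n ∂μ := by
        refine lintegral_mono fun x => ?_
        gcongr
        refine (Finset.prod_le_pow_card _ _ (ENNReal.ofReal C) fun i _ => ?_).trans (by simp)
        exact ENNReal.ofReal_le_ofReal (hC _)
    _ = (∫⁻ x, ENNReal.ofReal (f x) ∂μ) * (ENNReal.ofReal C) ^ n := by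
        rw [lintegral_mul_const'' _ hfi.aemeasurable.ennreal_ofReal]
    _ < ⊤ := by
        refine ENNReal.mul_lt_top ?_ (by simp)
        have := hfi.2
        rwa [hasFiniteIntegral_iff_ofReal (Filter.Eventually.of_forall hf)] at this

end Helpers

section Solenoid

set_option linter.unusedSectionVars false

variable {X : Type} [MeasurableSpace X]

lemma theta_meas (r : X → X) (n : ℕ) : Measurable (theta r n) :=
  (measurable_pi_apply n).comp measurable_subtype_coe

lemma theta_add (r : X → X) (n k : ℕ) (xh : Xinf r) :
    r^[k] (theta r (n + k) xh) = theta r n xh := by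
  induction k with
  | zero => rfl
  | succ k ih =>
    rw [Function.iterate_succ_apply, ← ih]
    congr 1
    exact xh.2 (n + k)

lemma theta_succ_rhat (r : X → X) (n : ℕ) (xh : Xinf r) :
    theta r (n + 1) (rhat r xh) = theta r n xh := rfl

lemma rhat_meas (r : X → X) (hr : Measurable r) : Measurable (rhat r) := by
  refine Measurable.subtype_mk (measurable_pi_lambda _ fun n => ?_)
  cases n with
  | zero => exact hr.comp (theta_meas r 0)
  | succ k => exact theta_meas r k

/-- Cylinder sets. -/
def cyl (r : X → X) : Set (Set (Xinf r)) :=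
  {S | ∃ n E, MeasurableSet E ∧ S = theta r n ⁻¹' E}

lemma cyl_gen (r : X → X) :
    (inferInstance : MeasurableSpace (Xinf r)) = MeasurableSpace.generateFrom (cyl r) := by
  apply le_antisymm
  · change MeasurableSpace.comap _ (MeasurableSpace.pi) ≤ _
    unfold MeasurableSpace.pi
    rw [MeasurableSpace.comap_iSup]
    refine iSup_le fun n => ?_
    rw [MeasurableSpace.comap_comp]
    rintro S ⟨E, hE, rfl⟩
    exact MeasurableSpace.measurableSet_generateFrom ⟨n, E, hE, rfl⟩
  · refine MeasurableSpace.generateFrom_le ?_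
    rintro S ⟨n, E, hE, rfl⟩
    exact theta_meas r n hE

lemma cyl_lift (r : X → X) (hr : Measurable r) (n k : ℕ) (E : Set X) (hE : MeasurableSet E) :
    ∃ F, MeasurableSet F ∧ theta r n ⁻¹' E = theta r (n + k) ⁻¹' F := by
  refine ⟨r^[k] ⁻¹' E, hr.iterate k hE, ?_⟩
  ext xh
  simp only [Set.mem_preimage, theta_add]

lemma cyl_pi (r : X → X) (hr : Measurable r) : IsPiSystem (cyl r) := by
  rintro _ ⟨n, E, hE, rfl⟩ _ ⟨m, F, hF, rfl⟩ -
  obtain ⟨E', hE', h1⟩ := cyl_lift r hr n m E hE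
  obtain ⟨F', hF', h2⟩ := cyl_lift r hr m n F hF
  rw [add_comm m n] at h2
  exact ⟨n + m, E' ∩ F', hE'.inter hF', by rw [h1, h2]; rfl⟩

variable (r : X → X) (hr : Measurable r)
    (W : X → ℝ≥0∞) (hW : Measurable W) (μ : Measure X)
    (h : X → ℝ≥0∞) (hmeas : Measurable h)
    (μhat : Measure (Xinf r))

lemma map_rhat (hr : Measurable r) (hW : Measurable W) (hmeas : Measurable h)
    [IsFiniteMeasure μhat]
    (hμ : ∀ (n : ℕ) (E : Set X), MeasurableSet E → μhat (theta r n ⁻¹' E) =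
      ∫⁻ x in E, h x * ∏ i ∈ Finset.range n, W (r^[i] x) ∂μ) :
    (μhat.withDensity (fun xh => W (theta r 0 xh))).map (rhat r) = μhat := by
  have hmap : ∀ n, μhat.map (theta r n) =
      μ.withDensity (fun x => h x * ∏ i ∈ Finset.range n, W (r^[i] x)) := by
    intro n
    ext E hE
    rw [Measure.map_apply (theta_meas r n) hE, withDensity_apply _ hE, hμ n E hE]
  have hp : ∀ n, Measurable (fun x => h x * ∏ i ∈ Finset.range n, W (r^[i] x)) := fun n =>
    hmeas.mul (Finset.measurable_fun_prod _ fun i _ => hW.comp (hr.iterate i))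
  have key : ∀ S ∈ cyl r, μhat S =
      (μhat.withDensity (fun xh => W (theta r 0 xh))).map (rhat r) S := by
    rintro _ ⟨n, E, hE, rfl⟩
    obtain ⟨F, hF, hEF⟩ := cyl_lift r hr n 1 E hE
    rw [hEF, Measure.map_apply (rhat_meas r hr) (theta_meas r _ hF)]
    have : rhat r ⁻¹' (theta r (n + 1) ⁻¹' F) = theta r n ⁻¹' F := rfl
    rw [this, withDensity_apply _ (theta_meas r _ hF)]
    have h2 : ∀ xh : Xinf r, W (theta r 0 xh) = W (r^[n] (theta r n xh)) := by
      intro xh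
      have := theta_add r 0 n xh
      rw [zero_add] at this
      rw [this]
    simp only [h2]
    have hWn : Measurable (fun x => W (r^[n] x)) := hW.comp (hr.iterate n)
    rw [← setLIntegral_map (f := fun x => W (r^[n] x)) hF hWn (theta_meas r n), hmap,
      setLIntegral_withDensity_eq_setLIntegral_mul _ (hp n) hWn hF, hμ _ _ hF]
    refine lintegral_congr fun x => ?_
    simp only [Pi.mul_apply]
    rw [Finset.prod_range_succ, mul_assoc]
  refine (ext_of_generate_finite (cyl r) (cyl_gen r) (cyl_pi r hr) key ?_).symm
  have := key (theta r 0 ⁻¹' Set.univ) ⟨0, Set.univ, MeasurableSet.univ, rfl⟩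
  simpa only [Set.preimage_univ] using this

lemma rhat_qmp (hr : Measurable r) (hW : Measurable W)
    (hmap : (μhat.withDensity (fun xh => W (theta r 0 xh))).map (rhat r) = μhat)
    (hne : ∀ᵐ xh ∂μhat, W (theta r 0 xh) ≠ 0) :
    Measure.QuasiMeasurePreserving (rhat r) μhat μhat := by
  refine ⟨rhat_meas r hr, ?_⟩
  conv_rhs => rw [← hmap]
  refine Measure.AbsolutelyContinuous.map ?_ (rhat_meas r hr)
  exact withDensity_absolutelyContinuous' (hW.comp (theta_meas r 0)).aemeasurable hne

/-- integrable functions with equal integrals on cylinders are a.e. equal. -/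
lemma ae_eq_of_cyl (hr : Measurable r) [IsFiniteMeasure μhat] (F G : Xinf r → ℂ)
    (hF : Integrable F μhat)
    (hG : Integrable G μhat) (hc : ∀ S ∈ cyl r, ∫ x in S, F x ∂μhat = ∫ x in S, G x ∂μhat) :
    F =ᵐ[μhat] G := by
  have hu : ∫ x, F x ∂μhat = ∫ x, G x ∂μhat := by
    have := hc Set.univ ⟨0, Set.univ, MeasurableSet.univ, rfl⟩
    simpa using this
  have hall : ∀ S, MeasurableSet S → ∫ x in S, F x ∂μhat = ∫ x in S, G x ∂μhat := by
    intro S hS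
    induction S, hS using MeasurableSpace.induction_on_inter (cyl_gen r) (cyl_pi r hr) with
    | empty => simp
    | basic t ht => exact hc t ht
    | compl t ht ih =>
      have h1 := integral_add_compl ht hF
      have h2 := integral_add_compl ht hG
      rw [ih, hu, ← h2] at h1
      exact add_left_cancel h1
    | iUnion f hd hm ih =>
      rw [integral_iUnion hm hd hF.integrableOn, integral_iUnion hm hd hG.integrableOn]
      simp only [ih]
  exact hF.ae_eq_of_forall_setIntegral_eq _ _ hG (fun S hS _ => hall S hS)

/-- multiplication by an indicator on L². -/
noncomputable def mulInd {Y : Type} [MeasurableSpace Y] {ν : Measure Y} (S : Set Y)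
    (hS : MeasurableSet S) (f : Lp ℂ 2 ν) : Lp ℂ 2 ν :=
  ((Lp.memLp f).indicator hS).toLp _

lemma mulInd_coe {Y : Type} [MeasurableSpace Y] {ν : Measure Y} (S : Set Y)
    (hS : MeasurableSet S) (f : Lp ℂ 2 ν) : mulInd S hS f =ᵐ[ν] S.indicator f :=
  MemLp.coeFn_toLp _

lemma inner_mulInd_right {Y : Type} [MeasurableSpace Y] {ν : Measure Y} (S : Set Y)
    (hS : MeasurableSet S) (f g : Lp ℂ 2 ν) :
    ⟪g, mulInd S hS f⟫_ℂ = ∫ x in S, ⟪g x, f x⟫_ℂ ∂ν := by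
  rw [L2.inner_def, ← integral_indicator hS]
  refine integral_congr_ae ?_
  filter_upwards [mulInd_coe S hS f] with x hx
  rw [hx]
  by_cases hxS : x ∈ S <;> simp [hxS]

lemma mult_of_commute (hr : Measurable r) [IsFiniteMeasure μhat]
    (A : Lp ℂ 2 μhat →L[ℂ] Lp ℂ 2 μhat)
    (hA : ∀ n E (hE : MeasurableSet E) f, A (mulInd (theta r n ⁻¹' E) (theta_meas r n hE) f) =
      mulInd (theta r n ⁻¹' E) (theta_meas r n hE) (A f)) (f g : Lp ℂ 2 μhat) :
    (fun x => ⟪(ContinuousLinearMap.adjoint A g) x, f x⟫_ℂ) =ᵐ[μhat]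
      fun x => ⟪g x, A f x⟫_ℂ := by
  refine ae_eq_of_cyl r μhat hr _ _ (L2.integrable_inner _ _) (L2.integrable_inner _ _) ?_
  rintro _ ⟨n, E, hE, rfl⟩
  rw [← inner_mulInd_right _ (theta_meas r n hE), ← inner_mulInd_right _ (theta_meas r n hE),
    ContinuousLinearMap.adjoint_inner_left, hA n E hE]

lemma bdd_of_mult {Y : Type} [MeasurableSpace Y] {ν : Measure Y} [IsFiniteMeasure ν]
    (A : Lp ℂ 2 ν →L[ℂ] Lp ℂ 2 ν) (c : Y → ℂ) (hc : Measurable c)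
    (hA : ∀ f, A f =ᵐ[ν] fun x => c x * f x) : ∀ᵐ x ∂ν, ‖c x‖ ≤ ‖A‖ := by
  have key : ∀ᵐ x ∂ν, (‖c x‖ₑ ^ 2) ≤ (‖A‖ₑ) ^ 2 := by
    refine ae_le_of_forall_setLIntegral_le_of_sigmaFinite (by fun_prop) ?_
    intro S hS hS'
    have hm : MemLp (S.indicator (fun _ => (1 : ℂ))) 2 ν := (memLp_const 1).indicator hS
    have h1 : eLpNorm (S.indicator c) 2 ν ≤ ‖A‖ₑ * eLpNorm (S.indicator (fun _ => (1 : ℂ))) 2 ν := by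
      have h2 : ‖A (hm.toLp _)‖ₑ ≤ ‖A‖ₑ * ‖hm.toLp _‖ₑ := A.le_opENorm _
      rw [Lp.enorm_toLp, Lp.enorm_def] at h2
      refine le_trans (le_of_eq ?_) h2
      refine eLpNorm_congr_ae ?_
      filter_upwards [hA (hm.toLp _), hm.coeFn_toLp] with x hx1 hx2
      rw [hx1, hx2]
      by_cases hxS : x ∈ S <;> simp [hxS]
    have h3 := ENNReal.pow_le_pow_left (n := 2) h1
    have e : ∀ F : Y → ℂ, (eLpNorm F 2 ν) ^ 2 = ∫⁻ x, ‖F x‖ₑ ^ 2 ∂ν := by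
      intro F
      have := eLpNorm_nnreal_pow_eq_lintegral (f := F) (μ := ν) (p := 2) two_ne_zero
      simpa using this
    rw [mul_pow, e, e] at h3
    have e2 : ∀ F : Y → ℂ, (fun x => ‖S.indicator F x‖ₑ ^ 2) = S.indicator (fun x => ‖F x‖ₑ ^ 2) := by
      intro F; funext x
      by_cases hxS : x ∈ S <;> simp [hxS]
    rw [e2, e2, lintegral_indicator hS, lintegral_indicator hS] at h3
    refine h3.trans (le_of_eq ?_)
    simp
  filter_upwards [key] with x hx
  have := (ENNReal.pow_le_pow_left_iff two_ne_zero).1 hx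
  rwa [enorm_le_iff_norm_le] at this

end Solenoid

set_option maxHeartbeats 2000000 in
/-- Theorem 4.18 (1): for a Perron–Ruelle–Frobenius pair `(m₀, h)` with `m₀` non-singular, a
bounded operator `A` on `L²(X_∞(r), μ̂)` commutes with `U` and with all `π(g)` if and only if
`A` is multiplication `M_f` by a cocycle `f` (a bounded measurable function on `X_∞(r)` with
`f ∘ r̂ = f` a.e.); conversely every cocycle defines an operator in the commutant. -/
theorem commutant_eq_cocycles
    (X : Type) [MeasurableSpace X] (r : X → X) (hr : Measurable r)
    (hsur : Function.Surjective r) (hfin : ∀ x, (r ⁻¹' {x}).Finite)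
    (μ : Measure X) [IsProbabilityMeasure μ] (hinv : StronglyInvariant r μ)
    (m₀ : X → ℂ) (hm₀ : BddMeasC m₀)
    (h : X → ℝ) (hmeas : Measurable h) (hint : Integrable h μ) (hpos : ∀ x, 0 ≤ h x)
    (hfix : ∀ᵐ x ∂μ, ruelle r (fun y => ‖m₀ y‖ ^ 2) h x = h x)
    (hns : μ {x | m₀ x = 0} = 0)
    (μhat : Measure (Xinf r))
    (hμhat : ∀ (n : ℕ) (E : Set X), MeasurableSet E →
      μhat (theta r n ⁻¹' E) =
        ENNReal.ofReal (∫ x, (ruelle r fun y => ‖m₀ y‖ ^ 2)^[n] (E.indicator h) x ∂μ))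
    (U : Lp ℂ 2 μhat ≃ₗᵢ[ℂ] Lp ℂ 2 μhat)
    (hU : ∀ f : Lp ℂ 2 μhat,
      ⇑(U f) =ᵐ[μhat] fun xh => m₀ (theta r 0 xh) * f (rhat r xh))
    (π : (X → ℂ) → (Lp ℂ 2 μhat →L[ℂ] Lp ℂ 2 μhat))
    (hπ : ∀ g : X → ℂ, BddMeasC g → ∀ f : Lp ℂ 2 μhat,
      ⇑(π g f) =ᵐ[μhat] fun xh => g (theta r 0 xh) * f xh)
    (A : Lp ℂ 2 μhat →L[ℂ] Lp ℂ 2 μhat) :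
    ((∀ f : Lp ℂ 2 μhat, A (U f) = U (A f)) ∧
      ∀ g : X → ℂ, BddMeasC g → ∀ f : Lp ℂ 2 μhat, A (π g f) = π g (A f)) ↔
    ∃ c : Xinf r → ℂ, Measurable c ∧ (∃ C, ∀ xh, ‖c xh‖ ≤ C) ∧
      (c ∘ rhat r =ᵐ[μhat] c) ∧
      ∀ f : Lp ℂ 2 μhat, ⇑(A f) =ᵐ[μhat] fun xh => c xh * f xh := by
  obtain ⟨hm₀m, C, hC⟩ := hm₀
  have hWm : Measurable (fun y => ‖m₀ y‖ ^ 2) := by fun_prop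
  have hform : ∀ (n : ℕ) (E : Set X), MeasurableSet E → μhat (theta r n ⁻¹' E) =
      ∫⁻ x in E, ENNReal.ofReal (h x) *
        ∏ i ∈ Finset.range n, ENNReal.ofReal (‖m₀ (r^[i] x)‖ ^ 2) ∂μ := by
    intro n E hE
    rw [hμhat n E hE, ruelle_formula r hr hsur hfin μ hinv (fun y => ‖m₀ y‖ ^ 2) hWm
      (fun x => by positivity) (C ^ 2) (fun x => by gcongr; exact hC x) _ (hint.indicator hE)
      (fun x => Set.indicator_nonneg (fun y _ => hpos y) x), ← lintegral_indicator hE]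
    refine lintegral_congr fun x => ?_
    by_cases hx : x ∈ E <;> simp [hx]
  have hfinm : IsFiniteMeasure μhat := by
    refine ⟨?_⟩
    have := hμhat 0 Set.univ MeasurableSet.univ
    rw [Set.preimage_univ] at this
    rw [this]
    exact ENNReal.ofReal_lt_top
  have hne : ∀ᵐ xh ∂μhat, m₀ (theta r 0 xh) ≠ 0 := by
    have hE : MeasurableSet {x | m₀ x = 0} := hm₀m (measurableSet_singleton 0)
    have := hform 0 _ hE
    rw [setLIntegral_measure_zero _ _ hns] at this
    rw [ae_iff]
    simpa using this
  have hq : Measure.QuasiMeasurePreserving (rhat r) μhat μhat := by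
    refine rhat_qmp r (fun y => ENNReal.ofReal (‖m₀ y‖ ^ 2)) μhat hr hWm.ennreal_ofReal
      (map_rhat r (fun y => ENNReal.ofReal (‖m₀ y‖ ^ 2)) μ (fun x => ENNReal.ofReal (h x)) μhat hr hWm.ennreal_ofReal hmeas.ennreal_ofReal hform) ?_
    filter_upwards [hne] with x hx
    have : 0 < ‖m₀ (theta r 0 x)‖ := norm_pos_iff.2 hx
    simp only [ne_eq, ENNReal.ofReal_eq_zero, not_le]
    positivity
  constructor
  · rintro ⟨hAU, hAπ⟩
    have hcomm : ∀ n E (hE : MeasurableSet E) f,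
        A (mulInd (theta r n ⁻¹' E) (theta_meas r n hE) f) =
        mulInd (theta r n ⁻¹' E) (theta_meas r n hE) (A f) := by
      intro n
      induction n with
      | zero =>
        intro E hE f
        have hb : BddMeasC (E.indicator (1 : X → ℂ)) :=
          ⟨measurable_one.indicator hE, 1, fun x => by by_cases hx : x ∈ E <;> simp [hx]⟩
        have hπi : ∀ f : Lp ℂ 2 μhat, π (E.indicator 1) f =
            mulInd (theta r 0 ⁻¹' E) (theta_meas r 0 hE) f := by
          intro f
          refine Lp.ext ?_
          filter_upwards [hπ _ hb f, mulInd_coe _ (theta_meas r 0 hE) f] with x h1 h2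
          rw [h1, h2]
          by_cases hx : theta r 0 x ∈ E <;> simp [hx]
        rw [← hπi, ← hπi, hAπ _ hb]
      | succ n ih =>
        intro E hE f
        have hUi : ∀ f : Lp ℂ 2 μhat,
            U (mulInd (theta r (n + 1) ⁻¹' E) (theta_meas r (n + 1) hE) f) =
            mulInd (theta r n ⁻¹' E) (theta_meas r n hE) (U f) := by
          intro f
          refine Lp.ext ?_
          filter_upwards [hU (mulInd (theta r (n + 1) ⁻¹' E) (theta_meas r (n + 1) hE) f),
            mulInd_coe _ (theta_meas r n hE) (U f), hU f,
            hq.ae (mulInd_coe _ (theta_meas r (n + 1) hE) f)] with x h1 h2 h3 h4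
          rw [h1, h2, h4]
          by_cases hx : theta r n x ∈ E
          · simp [hx, theta_succ_rhat, h3]
          · simp [hx, theta_succ_rhat]
        apply U.injective
        rw [← hAU, hUi, hUi, ih E hE, hAU]
    let one : Lp ℂ 2 μhat := (memLp_const (1 : ℂ)).toLp (fun _ => (1 : ℂ))
    have hone : one =ᵐ[μhat] fun _ => (1 : ℂ) := MemLp.coeFn_toLp _
    let B := ContinuousLinearMap.adjoint A one
    let c₀ : Xinf r → ℂ := fun x => (starRingEnd ℂ) (B x)
    have hc₀ : Measurable c₀ :=
      Complex.continuous_conj.measurable.comp (Lp.stronglyMeasurable B).measurable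
    have hmul : ∀ f, A f =ᵐ[μhat] fun x => c₀ x * f x := by
      intro f
      filter_upwards [mult_of_commute r μhat hr A hcomm f one, hone] with x h1 h2
      rw [h2] at h1
      simp only [RCLike.inner_apply, map_one, mul_one] at h1
      rw [← h1, mul_comm]
    have hbd := bdd_of_mult A c₀ hc₀ hmul
    have hS : MeasurableSet {x | ‖c₀ x‖ ≤ ‖A‖} :=
      measurableSet_le hc₀.norm measurable_const
    let c : Xinf r → ℂ := {x | ‖c₀ x‖ ≤ ‖A‖}.indicator c₀
    have hcc : c =ᵐ[μhat] c₀ := by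
      filter_upwards [hbd] with x hx
      exact Set.indicator_of_mem (s := {x | ‖c₀ x‖ ≤ ‖A‖}) hx c₀
    have hmulc : ∀ f, A f =ᵐ[μhat] fun x => c x * f x := by
      intro f
      filter_upwards [hmul f, hcc] with x h1 h2
      rw [h1, h2]
    refine ⟨c, hc₀.indicator hS, ⟨‖A‖, fun x => ?_⟩, ?_, hmulc⟩
    · by_cases hx : x ∈ {x | ‖c₀ x‖ ≤ ‖A‖}
      · simp only [c, Set.indicator_of_mem hx]; exact hx
      · simp only [c, Set.indicator_of_notMem hx]; simp
    · have e : A (U one) =ᵐ[μhat] U (A one) := by rw [hAU]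
      filter_upwards [e, hmulc (U one), hU one, hU (A one), hq.ae (hmulc one), hq.ae hone, hne]
        with x h1 h2 h3 h4 h5 h6 h7
      rw [h2, h3, h4, h5, h6, mul_one, mul_one, mul_comm] at h1
      exact (mul_left_cancel₀ h7 h1).symm
  · rintro ⟨c, hc, -, hinvc, hmul⟩
    refine ⟨fun f => Lp.ext ?_, fun g hg f => Lp.ext ?_⟩
    · filter_upwards [hmul (U f), hU f, hU (A f), hq.ae (hmul f), hinvc] with x h1 h2 h3 h4 h5
      rw [h1, h2, h3, h4, ← h5, Function.comp_apply]
      ring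
    · filter_upwards [hmul (π g f), hπ g hg f, hπ g hg (A f), hmul f] with x h1 h2 h3 h4
      rw [h1, h2, h3, h4]
      ring
end
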